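/- Assume a + A > 0, h/k ∉ 𝒬_{a,b,A,B}, and v₂(k) > v₂(B) (2-adic valuations). Then k' is even and lim_{t→0⁺} g₂(ζ_b^a q(t)^A; q(t)^B) = ∑_{n=0}^{k'/2 − 1} ζ_k^{hBn(n+1)/2} (−ζ_k^{hB};ζ_k^{hB})_n / [ (ζ_b^aζ_k^{hA};ζ_k^{hB})_{n+1} (ζ_b^{−a}ζ_k^{h(B−A)};ζ_k^{hB})_{n+1} ], and all denominators of this finite sum are nonzero. -/

import Mathlib

open scoped BigOperators Classical
open Filter Topology

noncomputable section

/-- finite q-Pochhammer symbol $(x;q)_n$ -/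
def qPoch (x q : ℂ) (n : ℕ) : ℂ := ∏ j ∈ Finset.range n, (1 - x * q ^ j)

/-- infinite q-Pochhammer symbol $(x;q)_\infty$ -/
def qPochInf (x q : ℂ) : ℂ := ∏' j : ℕ, (1 - x * q ^ j)

/-- $e(x) = e^{2\pi i x}$ -/
def ee (x : ℂ) : ℂ := Complex.exp (2 * Real.pi * Complex.I * x)

/-- $\zeta_n^m = e(m/n)$ -/
def zeta (m : ℤ) (n : ℕ) : ℂ := ee ((m : ℂ) / (n : ℂ))

/-- Dedekind eta -/
def eta (τ : ℂ) : ℂ := Complex.exp (Real.pi * Complex.I * τ / 12) * qPochInf (ee τ) (ee τ)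

/-- Jacobi theta -/
def theta (z τ : ℂ) : ℂ :=
  -Complex.I * Complex.exp (Real.pi * Complex.I * τ / 4) * Complex.exp (-(Real.pi * Complex.I * z))
    * qPochInf (ee τ) (ee τ) * qPochInf (ee z) (ee τ) * qPochInf ((ee z)⁻¹ * ee τ) (ee τ)

/-- universal mock theta function g₂ -/
def g2 (ζ q : ℂ) : ℂ :=
  ∑' n : ℕ, qPoch (-q) q n * q ^ (n * (n + 1) / 2) /
    (qPoch ζ q (n + 1) * qPoch (ζ⁻¹ * q) q (n + 1))

/-- universal mock theta function g₃ -/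
def g3 (ζ q : ℂ) : ℂ :=
  ∑' n : ℕ, q ^ (n * (n + 1)) / (qPoch ζ q (n + 1) * qPoch (ζ⁻¹ * q) q (n + 1))

/-- the series L -/
def Lser (ζ q : ℂ) : ℂ :=
  (1 / 2) * ∑' n : ℕ, q ^ n * qPoch (ζ⁻¹ * q) q n * qPoch ζ q n / qPoch (-q) q n

/-- the function M -/
def Mfun (z τ : ℂ) : ℂ :=
  -(Complex.I / 2) * Complex.exp (Real.pi * Complex.I * z) * theta z τ *
    g3 (-(ee z)) (ee τ) / (Complex.exp (Real.pi * Complex.I * τ / 12) * eta (2 * τ))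

/-- the function T -/
def Tfun (z τ : ℂ) : ℂ :=
  -Complex.I * eta (2 * τ) ^ 4 / (ee z * eta τ ^ 2 * theta (2 * z) (2 * τ))
  - Complex.I * eta (2 * τ) ^ 10 * theta (2 * z + 1 / 2) (2 * τ) /
      (2 * ee z ^ 2 * Complex.exp (Real.pi * Complex.I * τ / 2) * eta τ ^ 4 * eta (4 * τ) ^ 4 *
        theta (2 * z) (2 * τ) * theta (2 * z + τ + 1 / 2) (2 * τ))
  - Complex.I * eta (2 * τ) ^ 4 * theta z τ /
      (2 * Complex.exp (Real.pi * Complex.I * τ / 2) * ee z ^ 2 * eta (4 * τ) ^ 2 *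
        theta (z + 1 / 2) τ * theta (2 * z + τ + 1 / 2) (2 * τ))

/-- the function K -/
def Kfun (z τ : ℂ) : ℂ :=
  eta (2 * τ) ^ 4 / (Complex.I * ee z * eta τ ^ 2 * theta (2 * z) (2 * τ))

/-- Zwegers' μ-function -/
def mu (z₁ z₂ τ : ℂ) : ℂ :=
  Complex.exp (Real.pi * Complex.I * z₁) / theta z₂ τ *
    ∑' n : ℤ, (-(ee z₂)) ^ n * Complex.exp (Real.pi * Complex.I * (n : ℂ) * ((n : ℂ) + 1) * τ) /
      (1 - ee z₁ * (ee τ) ^ n)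

/-- the Appell–Lerch sum A -/
def appell (ζ q : ℂ) : ℂ :=
  ∑' n : ℤ, (-1 : ℂ) ^ n * q ^ ((3 * n * (n + 1)) / 2) / (1 + ζ * q ^ n)

/-- the function Θ -/
def bigTheta (z₁ z₂ z τ : ℂ) : ℂ :=
  (1 / (2 * Real.pi * Complex.I)) * deriv (fun w => theta w τ) 0 *
    theta (z₁ + z₂ + z) τ * theta z τ /
    (theta z₁ τ * theta z₂ τ * theta (z₁ + z) τ * theta (z₂ + z) τ)

/-- the function 𝔱 -/
def tfrak (z τ : ℂ) : ℂ :=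
  Kfun z τ - Complex.I * Kfun (z + 1 / 4) (τ + 1 / 2) +
    Complex.I * Complex.exp (-(Real.pi * Complex.I * τ / 2)) * bigTheta (2 * z) τ (1 / 2) (2 * τ)

/-- the second order mock theta function B -/
def mockB (q : ℂ) : ℂ :=
  ∑' n : ℕ, q ^ n * qPoch (-q) (q ^ 2) n / qPoch q (q ^ 2) (n + 1)

/-- Ramanujan's third order mock theta function f -/
def mockf (q : ℂ) : ℂ := ∑' n : ℕ, q ^ (n ^ 2) / qPoch (-q) q n ^ 2

/-- the modular form b -/
def bfun (q : ℂ) : ℂ := qPochInf q q / qPochInf (-q) q ^ 2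

/-- τ(t) = h/k + it/(2π) -/
def tauT (h k : ℕ) (t : ℝ) : ℂ := (h : ℂ) / (k : ℂ) + Complex.I * (t : ℂ) / (2 * Real.pi)

/-- q(t) = e^{2πiτ(t)} -/
def qT (h k : ℕ) (t : ℝ) : ℂ := ee (tauT h k t)

theorem triangle_succ (n : ℕ) : (n + 1) * (n + 1 + 1) / 2 = n * (n + 1) / 2 + (n + 1) := by
  have : (n + 1) * (n + 1 + 1) = n * (n + 1) + (n + 1) * 2 := by ring
  rw [this, Nat.add_mul_div_right _ _ two_pos]

theorem two_mul_triangle (n : ℕ) : n * (n + 1) / 2 + n * (n + 1) / 2 = n * (n + 1) := by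
  have := Nat.div_mul_cancel (Nat.even_mul_succ_self n).two_dvd
  omega

theorem qPoch_succ (x q : ℂ) (n : ℕ) : qPoch x q (n + 1) = qPoch x q n * (1 - x * q ^ n) :=
  Finset.prod_range_succ _ _

theorem qPoch_zero (x q : ℂ) : qPoch x q 0 = 1 := Finset.prod_range_zero _

theorem qPoch_self_succ (q : ℂ) (n : ℕ) :
    qPoch q q (n + 1) = qPoch q q n * (1 - q ^ (n + 1)) := by
  rw [qPoch_succ, pow_succ']

theorem qPoch_neg_self_succ (q : ℂ) (n : ℕ) :
    qPoch (-q) q (n + 1) = qPoch (-q) q n * (1 + q ^ (n + 1)) := by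
  rw [qPoch_succ, pow_succ']; ring

theorem one_sub_pow_ne_zero {q : ℂ} (hq : ‖q‖ < 1) {n : ℕ} (hn : n ≠ 0) : 1 - q ^ n ≠ 0 := by
  intro h
  have h1 : ‖q‖ ^ n = 1 := by rw [← norm_pow, ← sub_eq_zero.mp h, norm_one]
  exact (pow_lt_one₀ (norm_nonneg q) hq hn).ne h1

theorem qPoch_self_ne_zero {q : ℂ} (hq : ‖q‖ < 1) (n : ℕ) : qPoch q q n ≠ 0 := by
  refine Finset.prod_ne_zero_iff.mpr fun j _ => ?_
  rw [← pow_succ']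
  exact one_sub_pow_ne_zero hq j.succ_ne_zero

theorem summable_norm_mul_pow (x : ℂ) {q : ℂ} (hq : ‖q‖ < 1) :
    Summable fun j : ℕ => ‖-(x * q ^ j)‖ := by
  simp only [norm_neg, norm_mul, norm_pow]
  exact (summable_geometric_of_lt_one (norm_nonneg q) hq).mul_left _

theorem tendsto_qPoch (x : ℂ) {q : ℂ} (hq : ‖q‖ < 1) :
    Tendsto (qPoch x q) atTop (𝓝 (∏' j : ℕ, (1 + -(x * q ^ j)))) := by
  have h := (multipliable_one_add_of_summable (summable_norm_mul_pow x hq)).hasProd.tendsto_prod_nat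
  simp only [← sub_eq_add_neg] at h ⊢
  exact h

theorem exists_norm_qPoch_le (x : ℂ) {q : ℂ} (hq : ‖q‖ < 1) :
    ∃ C : ℝ, ∀ n, ‖qPoch x q n‖ ≤ C := by
  obtain ⟨C, hC⟩ := (Metric.isBounded_range_of_tendsto _ (tendsto_qPoch x hq)).exists_norm_le
  exact ⟨C, fun n => hC _ ⟨n, rfl⟩⟩

theorem exists_norm_inv_qPoch_self_le {q : ℂ} (hq : ‖q‖ < 1) :
    ∃ C : ℝ, ∀ n, ‖(qPoch q q n)⁻¹‖ ≤ C := by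
  have h0 : ∏' j : ℕ, (1 + -(q * q ^ j)) ≠ 0 := by
    refine tprod_one_add_ne_zero_of_summable (fun j => ?_) (summable_norm_mul_pow q hq)
    rw [← sub_eq_add_neg, ← pow_succ']
    exact one_sub_pow_ne_zero hq j.succ_ne_zero
  obtain ⟨C, hC⟩ :=
    (Metric.isBounded_range_of_tendsto _ ((tendsto_qPoch q hq).inv₀ h0)).exists_norm_le
  exact ⟨C, fun n => hC _ ⟨n, rfl⟩⟩

/-- The terms `q^(n(n+1)/2) (-q;q)_n / ((q;q)_(n-j) (q;q)_(n+j+1))` with `n = j + d`. -/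
def gaussTerm (q : ℂ) (j d : ℕ) : ℂ :=
  q ^ ((j + d) * (j + d + 1) / 2) * qPoch (-q) q (j + d) *
    ((qPoch q q d)⁻¹ * (qPoch q q (2 * j + d + 1))⁻¹)

theorem exists_norm_gaussTerm_le {q : ℂ} (hq : ‖q‖ < 1) :
    ∃ C : ℝ, ∀ j d, ‖gaussTerm q j d‖ ≤ C * (√‖q‖ ^ j * √‖q‖ ^ d) := by
  obtain ⟨C₁, h₁⟩ := exists_norm_qPoch_le (-q) hq
  obtain ⟨C₂, h₂⟩ := exists_norm_inv_qPoch_self_le hq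
  have h₁0 : 0 ≤ C₁ := (norm_nonneg _).trans (h₁ 0)
  have h₂0 : 0 ≤ C₂ := (norm_nonneg _).trans (h₂ 0)
  refine ⟨C₁ * (C₂ * C₂), fun j d => ?_⟩
  have hs : √‖q‖ ≤ 1 := Real.sqrt_le_one.mpr hq.le
  have hpow : ‖q ^ ((j + d) * (j + d + 1) / 2)‖ ≤ √‖q‖ ^ j * √‖q‖ ^ d := by
    rw [norm_pow, ← pow_add]
    conv_lhs => rw [← Real.sq_sqrt (norm_nonneg q), ← pow_mul]
    refine pow_le_pow_of_le_one (Real.sqrt_nonneg _) hs ?_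
    have h1 := two_mul_triangle (j + d)
    nlinarith
  calc ‖gaussTerm q j d‖
      = ‖q ^ ((j + d) * (j + d + 1) / 2)‖ * ‖qPoch (-q) q (j + d)‖ *
        (‖(qPoch q q d)⁻¹‖ * ‖(qPoch q q (2 * j + d + 1))⁻¹‖) := by
          simp only [gaussTerm, norm_mul]
    _ ≤ (√‖q‖ ^ j * √‖q‖ ^ d) * C₁ * (C₂ * C₂) := by
          gcongr
          exacts [h₁ _, h₂ _, h₂ _]
    _ = _ := by ring

theorem summable_mul_gaussTerm {q : ℂ} (hq : ‖q‖ < 1) {α : ℕ → ℂ} {C : ℝ}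
    (hα : ∀ j, ‖α j‖ ≤ C) :
    Summable fun x : ℕ × ℕ => α x.1 * gaussTerm q x.1 x.2 := by
  obtain ⟨M, hM⟩ := exists_norm_gaussTerm_le hq
  have hC : 0 ≤ C := (norm_nonneg _).trans (hα 0)
  have hg : Summable fun n : ℕ => √‖q‖ ^ n :=
    summable_geometric_of_lt_one (Real.sqrt_nonneg _) ((Real.sqrt_lt' one_pos).mpr (by simpa using hq))
  refine Summable.of_norm_bounded (g := fun x : ℕ × ℕ => C * M * (√‖q‖ ^ x.1 * √‖q‖ ^ x.2))
    ((hg.mul_of_nonneg hg (fun _ => by positivity) fun _ => by positivity).mul_left _) fun x => ?_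
  rw [norm_mul, mul_assoc]
  exact mul_le_mul (hα _) (hM _ _) (norm_nonneg _) hC

theorem summable_gaussTerm {q : ℂ} (hq : ‖q‖ < 1) (j : ℕ) : Summable (gaussTerm q j) := by
  have := summable_mul_gaussTerm hq (α := fun _ => 1) (C := 1) (by simp)
  simpa using this.prod_factor j

theorem gaussTerm_zero_succ {q : ℂ} (hq : ‖q‖ < 1) (j : ℕ) :
    (1 - q ^ (j + 1)) * ((1 - q ^ (2 * j + 3)) * gaussTerm q (j + 1) 0) =
      q ^ (j + 1) * gaussTerm q j 0 := by
  have h1 := one_sub_pow_ne_zero hq (n := 2 * j + 1 + 1) (by omega)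
  have h2 := one_sub_pow_ne_zero hq (n := 2 * j + 1 + 1 + 1) (by omega)
  have h3 := qPoch_self_ne_zero hq (2 * j + 1)
  simp only [gaussTerm, add_zero, qPoch_zero]
  rw [show 2 * (j + 1) + 1 = 2 * j + 1 + 1 + 1 by ring, triangle_succ, qPoch_self_succ q (2 * j + 1 + 1),
    qPoch_self_succ q (2 * j + 1), qPoch_neg_self_succ, show 2 * j + 3 = 2 * j + 1 + 1 + 1 by ring]
  field_simp
  ring

theorem gaussTerm_succ_sub {q : ℂ} (hq : ‖q‖ < 1) (j d : ℕ) :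
    gaussTerm q (j + 1) d - q ^ (j + 1) * gaussTerm q j (d + 1) =
      (1 - q ^ (j + 1)) * ((1 - q ^ (2 * j + d + 3)) * gaussTerm q (j + 1) d -
        (1 - q ^ (2 * j + (d + 1) + 3)) * gaussTerm q (j + 1) (d + 1)) := by
  obtain ⟨m, hm⟩ : ∃ m, m = 2 * j + d + 2 := ⟨_, rfl⟩
  have h0 := one_sub_pow_ne_zero hq (n := d + 1) (by omega)
  have h1 := one_sub_pow_ne_zero hq (n := m + 1) (by omega)
  have h2 := one_sub_pow_ne_zero hq (n := m + 1 + 1) (by omega)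
  have h3 := qPoch_self_ne_zero hq m
  have h4 := qPoch_self_ne_zero hq d
  simp only [gaussTerm]
  rw [show j + 1 + (d + 1) = j + d + 1 + 1 by ring, show j + 1 + d = j + d + 1 by ring,
    show j + (d + 1) = j + d + 1 by ring,
    show 2 * (j + 1) + (d + 1) + 1 = m + 1 + 1 by omega,
    show 2 * (j + 1) + d + 1 = m + 1 by omega,
    show 2 * j + (d + 1) + 1 = m by omega,
    show 2 * j + (d + 1) + 3 = m + 1 + 1 by omega,
    show 2 * j + d + 3 = m + 1 by omega, triangle_succ (j + d + 1), qPoch_self_succ q (m + 1),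
    qPoch_self_succ q m, qPoch_self_succ q d, qPoch_neg_self_succ q (j + d + 1)]
  field_simp
  rw [hm]
  ring

theorem tsum_gaussTerm_succ {q : ℂ} (hq : ‖q‖ < 1) (j : ℕ) :
    ∑' d, gaussTerm q (j + 1) d = q ^ (j + 1) * ∑' d, gaussTerm q j d := by
  have hS := summable_gaussTerm hq
  set T : ℕ → ℂ := fun d => (1 - q ^ (2 * j + d + 3)) * gaussTerm q (j + 1) d with hT
  have hTs : Summable T := by
    refine Summable.of_norm_bounded ((hS (j + 1)).norm.mul_left 2) fun d => ?_
    rw [hT, norm_mul]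
    gcongr
    calc ‖1 - q ^ (2 * j + d + 3)‖ ≤ ‖(1 : ℂ)‖ + ‖q ^ (2 * j + d + 3)‖ := norm_sub_le _ _
      _ ≤ 1 + 1 := by
        rw [norm_one, norm_pow]
        gcongr
        exact pow_le_one₀ (norm_nonneg q) hq.le
      _ = 2 := by norm_num
  have hTs' : Summable fun d => T (d + 1) := (summable_nat_add_iff 1).mpr hTs
  have hS' : Summable fun d => gaussTerm q j (d + 1) := (summable_nat_add_iff 1).mpr (hS j)
  have key : ∑' d, gaussTerm q (j + 1) d - q ^ (j + 1) * ∑' d, gaussTerm q j (d + 1) =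
      (1 - q ^ (j + 1)) * (∑' d, T d - ∑' d, T (d + 1)) := by
    rw [← tsum_mul_left, ← (hS _).tsum_sub (hS'.mul_left _), ← hTs.tsum_sub hTs', ← tsum_mul_left]
    exact tsum_congr fun d => gaussTerm_succ_sub hq j d
  rw [hTs.tsum_eq_zero_add, add_sub_cancel_right] at key
  rw [(hS j).tsum_eq_zero_add, mul_add, ← gaussTerm_zero_succ hq j]
  linear_combination key

theorem tsum_gaussTerm {q : ℂ} (hq : ‖q‖ < 1) (j : ℕ) :
    ∑' d, gaussTerm q j d = q ^ (j * (j + 1) / 2) * ∑' d, gaussTerm q 0 d := by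
  induction j with
  | zero => simp
  | succ j ih => rw [tsum_gaussTerm_succ hq, ih, triangle_succ, pow_add]; ring

theorem tsum_sum_antidiagonal {f : ℕ × ℕ → ℂ} (hf : Summable f) :
    ∑' n, ∑ x ∈ Finset.HasAntidiagonal.antidiagonal n, f x = ∑' x, f x := by
  have hf' := Finset.HasAntidiagonal.sigmaAntidiagonalEquivProd.summable_iff.mpr hf
  rw [← Finset.HasAntidiagonal.sigmaAntidiagonalEquivProd.tsum_eq f]
  refine Eq.trans (tsum_congr fun n => ?_) (hf'.tsum_sigma' fun n => (hasSum_fintype _).summable).symm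
  rw [tsum_fintype, ← Finset.sum_finset_coe]
  rfl

/-- Bailey's lemma relative to `a = q`, for the conjugate pair attached to `(-q; q)_n`. -/
theorem tsum_bailey {q : ℂ} (hq : ‖q‖ < 1) {α : ℕ → ℂ} {C : ℝ} (hα : ∀ j, ‖α j‖ ≤ C) :
    ∑' n, q ^ (n * (n + 1) / 2) * qPoch (-q) q n *
        ∑ j ∈ Finset.range (n + 1), α j * ((qPoch q q (n - j))⁻¹ * (qPoch q q (n + 1 + j))⁻¹) =
      (∑' j, α j * q ^ (j * (j + 1) / 2)) * ∑' d, gaussTerm q 0 d := by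
  have hs := summable_mul_gaussTerm hq hα
  have key : ∑' n, ∑ x ∈ Finset.HasAntidiagonal.antidiagonal n, α x.1 * gaussTerm q x.1 x.2 =
      ∑' j, ∑' d, α j * gaussTerm q j d := (tsum_sum_antidiagonal hs).trans hs.tsum_prod
  have hr (j : ℕ) : ∑' d, α j * gaussTerm q j d =
      α j * q ^ (j * (j + 1) / 2) * ∑' d, gaussTerm q 0 d := by
    rw [tsum_mul_left, tsum_gaussTerm hq, mul_assoc]
  simp only [hr, tsum_mul_right] at key
  rw [← key]
  refine tsum_congr fun n => ?_
  rw [Finset.Nat.sum_antidiagonal_eq_sum_range_succ (fun i j => α i * gaussTerm q i j),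
    Finset.mul_sum]
  refine Finset.sum_congr rfl fun j hj => ?_
  have hj : j ≤ n := Nat.lt_succ_iff.mp (Finset.mem_range.mp hj)
  rw [gaussTerm, Nat.add_sub_cancel' hj, show 2 * j + (n - j) + 1 = n + 1 + j by omega]
  ring

theorem sum_unit_bailey_partial {q : ℂ} (hq : ‖q‖ < 1) (n j : ℕ) (hj : j ≤ n) :
    (1 - q ^ n) * ∑ i ∈ Finset.range (j + 1), (-1) ^ i * q ^ (i * (i - 1) / 2) * (1 - q ^ (2 * i + 1)) *
        ((qPoch q q (n - i))⁻¹ * (qPoch q q (n + 1 + i))⁻¹) =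
      (-1) ^ j * q ^ (j * (j + 1) / 2) * (1 - q ^ (j + 1)) * (1 - q ^ (n - j)) *
        ((qPoch q q (n - j))⁻¹ * (qPoch q q (n + 1 + j))⁻¹) := by
  induction j with
  | zero => simp; ring
  | succ j ih =>
    rw [Finset.sum_range_succ, mul_add, ih (by omega)]
    obtain ⟨d, rfl⟩ := Nat.exists_eq_add_of_le hj
    have h0 := one_sub_pow_ne_zero hq (n := d + 1) (by omega)
    have h1 := one_sub_pow_ne_zero hq (n := j + 1 + d + 1 + j + 1) (by omega)
    have h3 := qPoch_self_ne_zero hq (j + 1 + d + 1 + j)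
    have h4 := qPoch_self_ne_zero hq d
    rw [show j + 1 + d - j = d + 1 by omega, show j + 1 + d - (j + 1) = d by omega,
      show j + 1 + d + 1 + (j + 1) = j + 1 + d + 1 + j + 1 by ring, triangle_succ, qPoch_self_succ,
      qPoch_self_succ, Nat.add_sub_cancel, mul_comm (j + 1) j]
    field_simp
    ring

theorem sum_unit_bailey {q : ℂ} (hq : ‖q‖ < 1) (n : ℕ) :
    ∑ i ∈ Finset.range (n + 1), (-1) ^ i * q ^ (i * (i - 1) / 2) * (1 - q ^ (2 * i + 1)) *
        ((qPoch q q (n - i))⁻¹ * (qPoch q q (n + 1 + i))⁻¹) = if n = 0 then 1 else 0 := by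
  split_ifs with hn
  · subst hn
    have h := one_sub_pow_ne_zero hq one_ne_zero
    rw [pow_one] at h
    simp [qPoch_self_succ q 0, qPoch_zero, h]
  · have h := sum_unit_bailey_partial hq n n le_rfl
    rw [Nat.sub_self, pow_zero, sub_self, mul_zero, zero_mul] at h
    exact (mul_eq_zero.mp h).resolve_left (one_sub_pow_ne_zero hq hn)

theorem tsum_gaussTerm_mul_theta {q : ℂ} (hq : ‖q‖ < 1) :
    (∑' j : ℕ, (-1) ^ j * q ^ (j ^ 2) * (1 - q ^ (2 * j + 1))) * ∑' d, gaussTerm q 0 d = 1 := by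
  have hα : ∀ j : ℕ, ‖(-1) ^ j * q ^ (j * (j - 1) / 2) * (1 - q ^ (2 * j + 1))‖ ≤ 1 * (1 + 1) := by
    intro j
    rw [norm_mul, norm_mul, norm_pow, norm_neg, norm_one, one_pow, one_mul, norm_pow]
    have h1 := pow_le_one₀ (n := j * (j - 1) / 2) (norm_nonneg q) hq.le
    have h2 : ‖1 - q ^ (2 * j + 1)‖ ≤ 1 + 1 := (norm_sub_le _ _).trans <| by
      rw [norm_one, norm_pow]
      gcongr
      exact pow_le_one₀ (norm_nonneg q) hq.le
    exact mul_le_mul h1 h2 (norm_nonneg _) zero_le_one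
  have h := tsum_bailey hq hα
  simp only [sum_unit_bailey hq] at h
  rw [tsum_eq_single 0 fun n hn => by simp [hn]] at h
  simp only [qPoch_zero, zero_mul, Nat.zero_div, pow_zero, one_mul, if_pos] at h
  refine Eq.trans ?_ h.symm
  congr 1
  refine tsum_congr fun j => ?_
  have : j ^ 2 = j * (j - 1) / 2 + j * (j + 1) / 2 := by
    cases j with
    | zero => rfl
    | succ j =>
      have := two_mul_triangle j
      rw [triangle_succ, Nat.add_sub_cancel, mul_comm (j + 1) j]
      nlinarith
  rw [this, pow_add]
  ring

/-- Partial fraction expansion of `1 / ((x; q)_(n+1) (q / x; q)_(n+1))`. -/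
theorem sum_partial_fraction {q x : ℂ} (hq : ‖q‖ < 1) (hx : x ≠ 0)
    (h₁ : ∀ j : ℕ, 1 - x * q ^ j ≠ 0) (h₂ : ∀ j : ℕ, 1 - x⁻¹ * q * q ^ j ≠ 0) (n : ℕ) :
    ∑ j ∈ Finset.range (n + 1), (-1) ^ j * q ^ (j * (j + 1) / 2) * (1 - q ^ (2 * j + 1)) /
        ((1 - x * q ^ j) * (1 - x⁻¹ * q * q ^ j)) *
        ((qPoch q q (n - j))⁻¹ * (qPoch q q (n + 1 + j))⁻¹) =
      1 / (qPoch x q (n + 1) * qPoch (x⁻¹ * q) q (n + 1)) := by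
  induction n with
  | zero =>
    have h := one_sub_pow_ne_zero hq one_ne_zero
    rw [pow_one] at h
    simp [qPoch_self_succ q 0, qPoch_zero, qPoch_succ, div_eq_mul_inv]
    field_simp
  | succ n ih =>
    have hu := sum_unit_bailey hq (n + 1)
    rw [if_neg n.succ_ne_zero] at hu
    rw [qPoch_succ x q (n + 1), qPoch_succ (x⁻¹ * q) q (n + 1), mul_mul_mul_comm, ← div_div, ← ih,
      eq_div_iff (mul_ne_zero (h₁ _) (h₂ _))]
    rw [Finset.sum_mul]
    have hsplit : ∀ j ∈ Finset.range (n + 1 + 1),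
        (-1) ^ j * q ^ (j * (j + 1) / 2) * (1 - q ^ (2 * j + 1)) /
          ((1 - x * q ^ j) * (1 - x⁻¹ * q * q ^ j)) *
          ((qPoch q q (n + 1 - j))⁻¹ * (qPoch q q (n + 1 + 1 + j))⁻¹) *
          ((1 - x * q ^ (n + 1)) * (1 - x⁻¹ * q * q ^ (n + 1))) =
        q ^ (n + 1) * ((-1) ^ j * q ^ (j * (j - 1) / 2) * (1 - q ^ (2 * j + 1)) *
          ((qPoch q q (n + 1 - j))⁻¹ * (qPoch q q (n + 1 + 1 + j))⁻¹)) +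
        (-1) ^ j * q ^ (j * (j + 1) / 2) * (1 - q ^ (2 * j + 1)) /
          ((1 - x * q ^ j) * (1 - x⁻¹ * q * q ^ j)) *
          ((1 - q ^ (n + 1 - j)) * (qPoch q q (n + 1 - j))⁻¹ * (qPoch q q (n + 1 + j))⁻¹) := by
      intro j hj
      have htri : j * (j + 1) / 2 = j * (j - 1) / 2 + j := by
        cases j with
        | zero => rfl
        | succ j => rw [triangle_succ, Nat.add_sub_cancel, mul_comm (j + 1) j]
      obtain ⟨d, hd⟩ := Nat.exists_eq_add_of_le (Nat.lt_succ_iff.mp (Finset.mem_range.mp hj))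
      have h3 := qPoch_self_ne_zero hq d
      have h4 := qPoch_self_ne_zero hq (j + d + j)
      have h5 := one_sub_pow_ne_zero hq (n := j + d + j + 1) (by omega)
      have hD : (1 - x * q ^ (j + d)) * (1 - x⁻¹ * q * q ^ (j + d)) =
          q ^ d * ((1 - x * q ^ j) * (1 - x⁻¹ * q * q ^ j)) +
            (1 - q ^ d) * (1 - q ^ (j + d + j + 1)) := by
        field_simp
        ring
      have hD0 := mul_ne_zero (h₁ j) (h₂ j)
      rw [hd, Nat.add_sub_cancel_left, show j + d + 1 + j = j + d + j + 1 by ring, qPoch_self_succ,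
        htri, hD]
      generalize (1 - x * q ^ j) * (1 - x⁻¹ * q * q ^ j) = D at hD0 ⊢
      field_simp
      ring
    rw [Finset.sum_congr rfl hsplit, Finset.sum_add_distrib, ← Finset.mul_sum, hu, mul_zero, zero_add,
      Finset.sum_range_succ, Nat.sub_self, pow_zero, sub_self, zero_mul, zero_mul, mul_zero, add_zero]
    refine Finset.sum_congr rfl fun j hj => ?_
    obtain ⟨d, hd⟩ := Nat.exists_eq_add_of_le (Nat.lt_succ_iff.mp (Finset.mem_range.mp hj))
    rw [hd, show j + d + 1 - j = d + 1 by omega, show j + d - j = d by omega, qPoch_self_succ, mul_inv,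
      mul_comm (qPoch q q d)⁻¹, mul_inv_cancel_left₀ (one_sub_pow_ne_zero hq d.succ_ne_zero)]

/-- The Appell-Lerch representation of `g₂`, with the bilateral sums folded onto `j ≥ 0`. -/
theorem g2_mul_theta {q x : ℂ} (hq : ‖q‖ < 1) (hx : x ≠ 0) {c : ℝ} (hc : 0 < c)
    (h₁ : ∀ j : ℕ, c ≤ ‖1 - x * q ^ j‖) (h₂ : ∀ j : ℕ, c ≤ ‖1 - x⁻¹ * q * q ^ j‖) :
    g2 x q * ∑' j : ℕ, (-1) ^ j * q ^ (j ^ 2) * (1 - q ^ (2 * j + 1)) =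
      ∑' j : ℕ, (-1) ^ j * q ^ (j * (j + 1)) * (1 - q ^ (2 * j + 1)) /
        ((1 - x * q ^ j) * (1 - x⁻¹ * q * q ^ j)) := by
  have hα : ∀ j : ℕ, ‖(-1) ^ j * q ^ (j * (j + 1) / 2) * (1 - q ^ (2 * j + 1)) /
      ((1 - x * q ^ j) * (1 - x⁻¹ * q * q ^ j))‖ ≤ 1 * (1 + 1) / (c * c) := by
    intro j
    rw [norm_div, norm_mul, norm_mul, norm_mul, norm_pow, norm_neg, norm_one, one_pow, one_mul,
      norm_pow]
    have h3 : ‖1 - q ^ (2 * j + 1)‖ ≤ 1 + 1 := (norm_sub_le _ _).trans <| by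
      rw [norm_one, norm_pow]
      gcongr
      exact pow_le_one₀ (norm_nonneg q) hq.le
    gcongr
    exacts [pow_le_one₀ (norm_nonneg q) hq.le, h₁ j, h₂ j]
  have h := tsum_bailey hq hα
  simp only [sum_partial_fraction hq hx (fun j => norm_pos_iff.mp (hc.trans_le (h₁ j)))
    (fun j => norm_pos_iff.mp (hc.trans_le (h₂ j)))] at h
  have hg : g2 x q = (∑' j : ℕ, (-1) ^ j * q ^ (j * (j + 1)) * (1 - q ^ (2 * j + 1)) /
        ((1 - x * q ^ j) * (1 - x⁻¹ * q * q ^ j))) * ∑' d, gaussTerm q 0 d := by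
    rw [g2]
    convert h using 2
    · ext n; ring
    · refine tsum_congr fun j => ?_
      rw [show q ^ (j * (j + 1)) = q ^ (j * (j + 1) / 2) * q ^ (j * (j + 1) / 2) by
        rw [← pow_add, two_mul_triangle]]
      ring
  rw [hg, mul_assoc, mul_comm (∑' d, gaussTerm q 0 d), tsum_gaussTerm_mul_theta hq, mul_one]

theorem qPoch_succ' (x q : ℂ) (n : ℕ) : qPoch x q (n + 1) = (1 - x) * qPoch (x * q) q n := by
  rw [qPoch, Finset.prod_range_succ', pow_zero, mul_one, mul_comm, qPoch]
  simp only [pow_succ', mul_assoc]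

theorem qPoch_ne_zero {x q : ℂ} (h : ∀ j : ℕ, 1 - x * q ^ j ≠ 0) (n : ℕ) : qPoch x q n ≠ 0 :=
  Finset.prod_ne_zero_iff.mpr fun j _ => h j

/-- The summand of `g₂`. -/
def g2Term (x q : ℂ) (n : ℕ) : ℂ :=
  q ^ (n * (n + 1) / 2) * qPoch (-q) q n / (qPoch x q (n + 1) * qPoch (x⁻¹ * q) q (n + 1))

theorem g2Term_telescope {x q : ℂ} (hx : x ≠ 0) (hq : q ≠ 0) (hx1 : x ≠ 1)
    (h₁ : ∀ j : ℕ, 1 - x * q ^ j ≠ 0) (h₂ : ∀ j : ℕ, 1 - x⁻¹ * q * q ^ j ≠ 0) (n : ℕ) :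
    x ^ 2 * g2Term x q n + g2Term (x * q) q n =
      x * (1 - x) * (q ^ ((n + 1) * (n + 1 + 1) / 2) * qPoch (-q) q (n + 1)) /
          (qPoch x q (n + 1 + 1) * qPoch (x⁻¹ * q) q (n + 1)) -
        x * (1 - x) * (q ^ (n * (n + 1) / 2) * qPoch (-q) q n) /
          (qPoch x q (n + 1) * qPoch (x⁻¹ * q) q n) := by
  have hx1' : 1 - x ≠ 0 := sub_ne_zero.mpr hx1.symm
  have ha := qPoch_ne_zero h₁ (n + 1)
  have hb := qPoch_ne_zero h₂ n
  have h3 := h₁ (n + 1)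
  have h4 := h₂ n
  have h5 : qPoch (x * q) q (n + 1) = qPoch x q (n + 1) * (1 - x * q ^ (n + 1)) / (1 - x) := by
    rw [eq_div_iff hx1', mul_comm, ← qPoch_succ', qPoch_succ]
  have h6 : qPoch ((x * q)⁻¹ * q) q (n + 1) = (x - 1) / x * qPoch (x⁻¹ * q) q n := by
    rw [qPoch_succ', mul_inv, inv_mul_cancel_right₀ hq]
    congr 1
    field_simp
  have h8 : 1 - x⁻¹ * q * q ^ n = (x - q ^ (n + 1)) / x := by
    rw [mul_assoc, ← pow_succ']
    field_simp
  rw [h8] at h4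
  have h7 : x - q ^ (n + 1) ≠ 0 := fun h => h4 (by rw [h, zero_div])
  rw [g2Term, g2Term, h5, h6, qPoch_succ x q (n + 1), qPoch_succ (x⁻¹ * q) q n, triangle_succ,
    qPoch_neg_self_succ, pow_add q _ (n + 1), h8]
  generalize q ^ (n + 1) = Q at *
  generalize qPoch x q (n + 1) = a at *
  generalize qPoch (x⁻¹ * q) q n = b at *
  generalize qPoch (-q) q n = N
  generalize q ^ (n * (n + 1) / 2) = R
  clear h₁ h₂ h4 h5 h6 h8
  field_simp
  ring

section RootOfUnity

variable {ω : ℂ} {K : ℕ}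

theorem one_sub_mul_pow_ne_zero (hω : ω ^ K = 1) {x : ℂ} (hx : x ^ K ≠ 1) (j : ℕ) :
    1 - x * ω ^ j ≠ 0 := by
  intro h
  apply hx
  have h1 : (x * ω ^ j) ^ K = 1 := by rw [← sub_eq_zero.mp h, one_pow]
  rwa [mul_pow, ← pow_mul, mul_comm j, pow_mul, hω, one_pow, mul_one] at h1

theorem one_sub_inv_mul_pow_ne_zero (hω : ω ^ K = 1) {x : ℂ} (hx : x ^ K ≠ 1) (j : ℕ) :
    1 - x⁻¹ * ω * ω ^ j ≠ 0 := by
  rw [mul_assoc, ← pow_succ']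
  exact one_sub_mul_pow_ne_zero hω (by rwa [inv_pow, ne_eq, inv_eq_one]) _

theorem ne_one_of_pow_ne_one {x : ℂ} (hx : x ^ K ≠ 1) : x ≠ 1 := fun h => hx (by rw [h, one_pow])

/-- Functional equation of the terminating form of `g₂` at a root of unity of order `2 m`. -/
theorem sum_g2Term_functional {m : ℕ} (hm : m ≠ 0) (hω : ω ^ m = -1) {x : ℂ} (hx : x ≠ 0)
    (hxK : x ^ (2 * m) ≠ 1) :
    x ^ 2 * ∑ n ∈ Finset.range m, g2Term x ω n + ∑ n ∈ Finset.range m, g2Term (x * ω) ω n = -x := by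
  have hωK : ω ^ (2 * m) = 1 := by rw [mul_comm, pow_mul, hω]; norm_num
  have hω0 : ω ≠ 0 := fun h => by simp [h, hm] at hω
  have hx1 := ne_one_of_pow_ne_one hxK
  rw [Finset.mul_sum, ← Finset.sum_add_distrib]
  rw [Finset.sum_congr rfl fun n _ => g2Term_telescope hx hω0 hx1
    (one_sub_mul_pow_ne_zero hωK hxK) (one_sub_inv_mul_pow_ne_zero hωK hxK) n,
    Finset.sum_range_sub fun n => x * (1 - x) * (ω ^ (n * (n + 1) / 2) * qPoch (-ω) ω n) /
          (qPoch x ω (n + 1) * qPoch (x⁻¹ * ω) ω n)]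
  have hN : qPoch (-ω) ω m = 0 := by
    obtain ⟨l, rfl⟩ := Nat.exists_eq_succ_of_ne_zero hm
    rw [Nat.succ_eq_add_one] at hω
    rw [Nat.succ_eq_add_one, qPoch_neg_self_succ, hω, add_neg_cancel, mul_zero]
  have hx1' : 1 - x ≠ 0 := sub_ne_zero.mpr hx1.symm
  rw [hN]
  simp [qPoch_succ, qPoch_zero]
  field_simp

/-- The summand of the Appell-Lerch sum paired with `g₂`. -/
def appellTerm (x ω : ℂ) (n : ℕ) : ℂ := (-1) ^ n * ω ^ (n * (n + 1)) / (1 - x * ω ^ n)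

theorem sum_range_shift {M : Type*} [AddCommMonoid M] {f : ℕ → M} (hf : f K = f 0) :
    ∑ n ∈ Finset.range K, f (n + 1) = ∑ n ∈ Finset.range K, f n := by
  cases K with
  | zero => rfl
  | succ K => rw [Finset.sum_range_succ, hf, Finset.sum_range_succ' f]

theorem pow_eq_inv_of_add_eq (hω : ω ^ K = 1) {e n : ℕ} (h : e + n = K) : ω ^ e = (ω ^ n)⁻¹ :=
  eq_inv_of_mul_eq_one_left (by rw [← pow_add, h, hω])

theorem pow_reflect (hω : ω ^ K = 1) {e n : ℕ} (h : e + n + 1 = K) :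
    ω ^ (e * (e + 1)) = ω ^ (n * (n + 1)) := by
  rw [mul_comm, pow_mul, pow_eq_inv_of_add_eq hω (show e + 1 + n = K by omega), inv_pow, ← pow_mul,
    mul_comm, pow_mul, pow_eq_inv_of_add_eq hω (show e + (n + 1) = K from h), inv_pow,
    inv_inv, ← pow_mul, mul_comm]

theorem neg_one_pow_reflect (hK : Even K) {e n : ℕ} (h : e + n + 1 = K) :
    (-1 : ℂ) ^ e = -(-1) ^ n := by
  have h1 : (-1 : ℂ) ^ (e + n + 1) = 1 := by rw [h, hK.neg_one_pow]
  have h2 : (-1 : ℂ) ^ n * (-1) ^ n = 1 := by rw [← mul_pow]; norm_num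
  rw [pow_succ, pow_add] at h1
  linear_combination -(-1) ^ n * h1 - (-1) ^ e * h2

theorem sum_alternating_eq_zero (hK : Even K) (hω : ω ^ K = 1) :
    ∑ n ∈ Finset.range K, (-1 : ℂ) ^ n * ω ^ (n * (n + 1)) = 0 := by
  have h := Finset.sum_range_reflect (fun n => (-1 : ℂ) ^ n * ω ^ (n * (n + 1))) K
  have h' : ∀ n ∈ Finset.range K, (-1 : ℂ) ^ (K - 1 - n) * ω ^ ((K - 1 - n) * (K - 1 - n + 1)) =
      -((-1) ^ n * ω ^ (n * (n + 1))) := by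
    intro n hn
    have hn := Finset.mem_range.mp hn
    rw [pow_reflect hω (show K - 1 - n + n + 1 = K by omega),
      neg_one_pow_reflect hK (show K - 1 - n + n + 1 = K by omega), neg_mul]
  rw [Finset.sum_congr rfl h', Finset.sum_neg_distrib] at h
  exact CharZero.neg_eq_self_iff.mp h

theorem sum_appellTerm_functional (hK : Even K) (hω : ω ^ K = 1) {x : ℂ} (hxK : x ^ K ≠ 1) :
    x ^ 2 * ∑ n ∈ Finset.range K, appellTerm x ω n + ∑ n ∈ Finset.range K, appellTerm (x * ω) ω n =
      -x * ∑ n ∈ Finset.range K, (-1) ^ n * ω ^ (n ^ 2) := by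
  have hsh : ∑ n ∈ Finset.range K, appellTerm (x * ω) ω n =
      ∑ n ∈ Finset.range K, -((-1) ^ n * ω ^ (n * (n - 1))) / (1 - x * ω ^ n) := by
    rw [← sum_range_shift (f := fun n => -((-1) ^ n * ω ^ (n * (n - 1))) / (1 - x * ω ^ n))]
    · refine Finset.sum_congr rfl fun n _ => ?_
      rw [appellTerm, Nat.add_sub_cancel, mul_comm (n + 1) n]
      ring
    · simp [hK.neg_one_pow, pow_mul, hω]
  have hz : ∑ n ∈ Finset.range K, (-1 : ℂ) ^ n * ω ^ (n * (n - 1)) = 0 := by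
    rw [← sum_range_shift (f := fun n => (-1 : ℂ) ^ n * ω ^ (n * (n - 1)))
      (by simp [hK.neg_one_pow, pow_mul, hω]), ← neg_eq_zero, ← Finset.sum_neg_distrib,
      ← sum_alternating_eq_zero hK hω]
    refine Finset.sum_congr rfl fun n _ => ?_
    rw [Nat.add_sub_cancel, mul_comm (n + 1) n]
    ring
  have hterm : ∀ n : ℕ, x ^ 2 * appellTerm x ω n +
      -((-1) ^ n * ω ^ (n * (n - 1))) / (1 - x * ω ^ n) =
      -x * ((-1) ^ n * ω ^ (n ^ 2)) - (-1) ^ n * ω ^ (n * (n - 1)) := by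
    intro n
    have h1 := one_sub_mul_pow_ne_zero hω hxK n
    have h2 : ω ^ (n * (n + 1)) = ω ^ (n * (n - 1)) * ω ^ n * ω ^ n := by
      rw [← pow_add, ← pow_add]
      congr 1
      cases n with
      | zero => rfl
      | succ n => rw [Nat.add_sub_cancel]; ring
    have h3 : ω ^ (n ^ 2) = ω ^ (n * (n - 1)) * ω ^ n := by
      rw [← pow_add]
      congr 1
      cases n with
      | zero => rfl
      | succ n => rw [Nat.add_sub_cancel]; ring
    rw [appellTerm, h2, h3]
    field_simp
    ring
  rw [hsh, Finset.mul_sum, ← Finset.sum_add_distrib, Finset.sum_congr rfl fun n _ => hterm n,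
    Finset.sum_sub_distrib, hz, sub_zero, Finset.mul_sum]

theorem eq_zero_of_homogeneous (hω : ω ^ K = 1) (hω0 : ω ≠ 0) {D : ℂ → ℂ}
    (hD : ∀ x, x ≠ 0 → x ^ K ≠ 1 → x ^ 2 * D x + D (x * ω) = 0) (hK : Even K) {x : ℂ} (hx : x ≠ 0)
    (hxK : x ^ (2 * K) ≠ 1) : D x = 0 := by
  have hxK1 : x ^ K ≠ 1 := fun h => hxK (by rw [mul_comm, pow_mul, h, one_pow])
  have hit : ∀ n : ℕ, D (x * ω ^ n) = (-1) ^ n * x ^ (2 * n) * ω ^ (n * (n - 1)) * D x := by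
    intro n
    induction n with
    | zero => simp
    | succ n ih =>
      have h1 : (x * ω ^ n) ^ K ≠ 1 := by
        rwa [mul_pow, ← pow_mul, mul_comm n, pow_mul, hω, one_pow, mul_one]
      have h2 := hD _ (mul_ne_zero hx (pow_ne_zero n hω0)) h1
      rw [ih] at h2
      have h3 : (n + 1) * (n + 1 - 1) = 2 * n + n * (n - 1) := by
        cases n with
        | zero => rfl
        | succ n => simp only [Nat.add_sub_cancel]; ring
      rw [h3, pow_succ ω, ← mul_assoc, eq_neg_of_add_eq_zero_right h2]
      ring
  have h := hit K
  rw [hω, mul_one, hK.neg_one_pow, one_mul, pow_mul ω, hω, one_pow, mul_one] at h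
  have : (1 - x ^ (2 * K)) * D x = 0 := by linear_combination h
  exact (mul_eq_zero.mp this).resolve_left (sub_ne_zero.mpr hxK.symm)

theorem mul_ofReal_pow_ne_one {x : ℂ} (hx : ‖x‖ = 1) {s : ℝ} (hs : 1 < s) {n : ℕ} (hn : n ≠ 0) :
    (x * s) ^ n ≠ 1 := by
  intro h
  have h1 : ‖x * s‖ ^ n = 1 := by rw [← norm_pow, h, norm_one]
  rw [norm_mul, hx, one_mul, Complex.norm_real, Real.norm_of_nonneg (by linarith)] at h1
  exact (one_lt_pow₀ hs hn).ne' h1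

theorem tendsto_mul_ofReal (x : ℂ) : Tendsto (fun s : ℝ => x * s) (𝓝[>] 1) (𝓝 x) := by
  have : Continuous fun s : ℝ => x * s := by fun_prop
  have h := this.tendsto 1
  rw [Complex.ofReal_one, mul_one] at h
  exact h.mono_left nhdsWithin_le_nhds

theorem eq_zero_of_homogeneous_of_norm_eq_one (hω : ω ^ K = 1) (hK0 : K ≠ 0) {D : ℂ → ℂ}
    (hD : ∀ x, x ≠ 0 → x ^ K ≠ 1 → x ^ 2 * D x + D (x * ω) = 0) (hK : Even K) {x : ℂ}
    (hx : ‖x‖ = 1) (hc : ContinuousAt D x) : D x = 0 := by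
  have hω0 : ω ≠ 0 := fun h => by simp [h, hK0] at hω
  refine tendsto_nhds_unique (hc.tendsto.comp (tendsto_mul_ofReal x))
    (tendsto_const_nhds.congr' ?_)
  filter_upwards [self_mem_nhdsWithin] with s hs
  have hs : 1 < s := hs
  refine (eq_zero_of_homogeneous hω hω0 hD hK (mul_ne_zero ?_ ?_)
    (mul_ofReal_pow_ne_one hx hs (by omega))).symm
  · exact norm_ne_zero_iff.mp (by rw [hx]; exact one_ne_zero)
  · exact_mod_cast (by linarith : s ≠ 0)

theorem gaussSum_ne_zero (hω : IsPrimitiveRoot ω K) (hK0 : K ≠ 0) (hK : Even K) :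
    ∑ n ∈ Finset.range K, (-1) ^ n * ω ^ (n ^ 2) ≠ 0 := by
  intro hG
  obtain ⟨L, rfl⟩ := Nat.exists_eq_succ_of_ne_zero hK0
  have hω0 : ω ≠ 0 := hω.ne_zero hK0
  have h0 : ∀ s : ℝ, 1 < s → ∑ n ∈ Finset.range (L + 1), appellTerm (1 * s) ω n = 0 := by
    intro s hs
    refine eq_zero_of_homogeneous (D := fun x => ∑ n ∈ Finset.range (L + 1), appellTerm x ω n)
      hω.pow_eq_one hω0 (fun x _ hxK => ?_) hK ?_ (mul_ofReal_pow_ne_one norm_one hs (by omega))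
    · rw [sum_appellTerm_functional hK hω.pow_eq_one hxK, hG, mul_zero]
    · rw [one_mul]; exact_mod_cast (by linarith : s ≠ 0)
  have hlim : Tendsto (fun s : ℝ => 1 + (1 - 1 * (s : ℂ)) *
      ∑ n ∈ Finset.range L, appellTerm (1 * s) ω (n + 1)) (𝓝[>] 1) (𝓝 1) := by
    have hc : ContinuousAt (fun x : ℂ => 1 + (1 - x) *
        ∑ n ∈ Finset.range L, appellTerm x ω (n + 1)) 1 := by
      have : ContinuousAt (fun x : ℂ => ∑ n ∈ Finset.range L, appellTerm x ω (n + 1)) 1 := by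
        refine tendsto_finsetSum _ fun n hn => ?_
        refine ContinuousAt.div (by fun_prop) (by fun_prop) ?_
        rw [one_mul, sub_ne_zero]
        exact (hω.pow_ne_one_of_pos_of_lt n.succ_ne_zero
          (Nat.succ_lt_succ (Finset.mem_range.mp hn))).symm
      fun_prop
    have := hc.tendsto.comp (tendsto_mul_ofReal 1)
    simpa [Function.comp_def] using this
  refine one_ne_zero (tendsto_nhds_unique hlim (tendsto_const_nhds.congr' ?_))
  filter_upwards [self_mem_nhdsWithin] with s hs
  have hs : 1 < s := hs
  have h := h0 s hs
  have hs' : (1 : ℂ) - s ≠ 0 := by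
    rw [sub_ne_zero]; exact_mod_cast hs.ne
  rw [Finset.sum_range_succ'] at h
  have h1 : appellTerm (1 * s) ω 0 = 1 / (1 - s) := by simp [appellTerm]
  rw [h1] at h
  rw [eq_neg_of_add_eq_zero_left h]
  field_simp
  ring

theorem continuousAt_qPoch {f : ℂ → ℂ} {x : ℂ} (hf : ContinuousAt f x) (q : ℂ) (n : ℕ) :
    ContinuousAt (fun y => qPoch (f y) q n) x := by
  refine tendsto_finsetProd _ fun j _ => ?_
  exact (continuousAt_const.sub (hf.mul continuousAt_const)).tendsto

theorem sum_g2Term_mul_gaussSum {m : ℕ} (hm : m ≠ 0) (hω : ω ^ m = -1) {x : ℂ} (hx : ‖x‖ = 1)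
    (hxK : x ^ (2 * m) ≠ 1) :
    (∑ n ∈ Finset.range m, g2Term x ω n) * ∑ n ∈ Finset.range (2 * m), (-1) ^ n * ω ^ (n ^ 2) =
      ∑ n ∈ Finset.range (2 * m), appellTerm x ω n := by
  have hωK : ω ^ (2 * m) = 1 := by rw [mul_comm, pow_mul, hω]; norm_num
  have hx0 : x ≠ 0 := norm_ne_zero_iff.mp (by rw [hx]; exact one_ne_zero)
  rw [← sub_eq_zero]
  refine eq_zero_of_homogeneous_of_norm_eq_one (D := fun x => (∑ n ∈ Finset.range m, g2Term x ω n) *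
    ∑ n ∈ Finset.range (2 * m), (-1) ^ n * ω ^ (n ^ 2) - ∑ n ∈ Finset.range (2 * m), appellTerm x ω n)
    hωK (by omega) (fun y hy hyK => ?_) (even_two_mul m) hx ?_
  · linear_combination (∑ n ∈ Finset.range (2 * m), (-1) ^ n * ω ^ (n ^ 2)) *
      sum_g2Term_functional hm hω hy hyK - sum_appellTerm_functional (even_two_mul m) hωK hyK
  · refine ContinuousAt.sub (ContinuousAt.mul ?_ continuousAt_const) ?_
    · refine tendsto_finsetSum _ fun n hn => ?_
      refine ContinuousAt.div continuousAt_const ((continuousAt_qPoch continuousAt_id _ _).mul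
        (continuousAt_qPoch ((continuousAt_inv₀ hx0).mul continuousAt_const) _ _)) ?_
      exact mul_ne_zero (qPoch_ne_zero (one_sub_mul_pow_ne_zero hωK hxK) _)
        (qPoch_ne_zero (one_sub_inv_mul_pow_ne_zero hωK hxK) _)
    · refine tendsto_finsetSum _ fun n hn => ?_
      exact ContinuousAt.div (by fun_prop) (by fun_prop) (one_sub_mul_pow_ne_zero hωK hxK _)

end RootOfUnity

theorem summable_gaussWeight {r : ℝ} (h0 : 0 ≤ r) (h1 : r < 1) : Summable fun j : ℕ => r ^ (j ^ 2) :=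
  (summable_geometric_of_lt_one h0 h1).of_nonneg_of_le (fun _ => pow_nonneg h0 _) fun j =>
    pow_le_pow_of_le_one h0 h1.le (Nat.le_self_pow two_ne_zero j)

theorem hasSum_gaussWeight_diff {r : ℝ} (h0 : 0 ≤ r) (h1 : r < 1) :
    HasSum (fun j : ℕ => r ^ (j ^ 2) * (1 - r ^ (2 * j + 1))) 1 := by
  rw [hasSum_iff_tendsto_nat_of_nonneg fun j => mul_nonneg (pow_nonneg h0 _)
    (sub_nonneg.mpr (pow_le_one₀ h0 h1.le))]
  have h : ∀ n : ℕ, ∑ j ∈ Finset.range n, r ^ (j ^ 2) * (1 - r ^ (2 * j + 1)) = 1 - r ^ (n ^ 2) := by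
    intro n
    induction n with
    | zero => simp
    | succ n ih => rw [Finset.sum_range_succ, ih]; ring
  simp_rw [h]
  simpa using (summable_gaussWeight h0 h1).tendsto_atTop_zero.const_sub 1

theorem tendsto_tsum_gaussWeight :
    Tendsto (fun r : ℝ => ∑' j : ℕ, r ^ (j ^ 2)) (𝓝[<] 1) atTop := by
  refine tendsto_atTop.mpr fun M => ?_
  obtain ⟨N, hN⟩ := exists_nat_gt M
  have hc : Continuous fun r : ℝ => ∑ j ∈ Finset.range N, r ^ (j ^ 2) := by fun_prop
  have h := hc.tendsto 1
  simp only [one_pow, Finset.sum_const, Finset.card_range, nsmul_eq_mul, mul_one] at h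
  filter_upwards [(h.mono_left nhdsWithin_le_nhds).eventually_const_lt hN,
    Ioo_mem_nhdsLT zero_lt_one] with r hr hr1
  exact hr.le.trans ((summable_gaussWeight hr1.1.le hr1.2).sum_le_tsum _
    fun j _ => pow_nonneg hr1.1.le _)

theorem norm_tsum_mul_gaussWeight_le {r : ℝ} (h0 : 0 ≤ r) (h1 : r < 1) {c : ℕ → ℂ} {C : ℝ}
    (hc : ∀ j, ‖c j‖ ≤ C * (1 - r ^ (2 * j + 1))) :
    Summable (fun j => c j * (r : ℂ) ^ (j ^ 2)) ∧ ‖∑' j, c j * (r : ℂ) ^ (j ^ 2)‖ ≤ C := by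
  have h := (hasSum_gaussWeight_diff h0 h1).mul_left C
  have hle : ∀ j, ‖c j * (r : ℂ) ^ (j ^ 2)‖ ≤ C * (r ^ (j ^ 2) * (1 - r ^ (2 * j + 1))) := by
    intro j
    rw [norm_mul, norm_pow, Complex.norm_real, Real.norm_of_nonneg h0]
    calc _ ≤ C * (1 - r ^ (2 * j + 1)) * r ^ (j ^ 2) :=
          mul_le_mul_of_nonneg_right (hc j) (pow_nonneg h0 _)
      _ = _ := by ring
  rw [mul_one] at h
  exact ⟨h.summable.of_norm_bounded hle, tsum_of_norm_bounded h hle⟩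

/-- Abel summation against the weights `r ^ (j ^ 2)`. -/
theorem norm_tsum_mul_gaussWeight_le_of_sum_le {r : ℝ} (h0 : 0 ≤ r) (h1 : r < 1) {a : ℕ → ℂ} {M : ℝ}
    (ha : ∀ n, ‖∑ j ∈ Finset.range n, a j‖ ≤ M) :
    Summable (fun j => a j * (r : ℂ) ^ (j ^ 2)) ∧ ‖∑' j, a j * (r : ℂ) ^ (j ^ 2)‖ ≤ M := by
  have hw : ∀ j : ℕ, ‖(r : ℂ) ^ (j ^ 2)‖ = r ^ (j ^ 2) := fun j => by
    rw [norm_pow, Complex.norm_real, Real.norm_of_nonneg h0]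
  obtain ⟨hs, hle⟩ := norm_tsum_mul_gaussWeight_le h0 h1 (C := M)
    (c := fun j => (∑ i ∈ Finset.range (j + 1), a i) * (1 - (r : ℂ) ^ (2 * j + 1))) fun j => by
      have h2 : ‖1 - (r : ℂ) ^ (2 * j + 1)‖ = 1 - r ^ (2 * j + 1) := by
        rw [← Complex.ofReal_pow, ← Complex.ofReal_one, ← Complex.ofReal_sub, Complex.norm_real,
          Real.norm_of_nonneg (sub_nonneg.mpr (pow_le_one₀ h0 h1.le))]
      rw [norm_mul, h2]
      exact mul_le_mul_of_nonneg_right (ha _) (sub_nonneg.mpr (pow_le_one₀ h0 h1.le))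
  have ha' : ∀ j, ‖a j‖ ≤ M + M := fun j => by
    have : a j = (∑ i ∈ Finset.range (j + 1), a i) - ∑ i ∈ Finset.range j, a i := by
      rw [Finset.sum_range_succ]; ring
    rw [this]
    exact (norm_sub_le _ _).trans (add_le_add (ha _) (ha _))
  have hsa : Summable (fun j => a j * (r : ℂ) ^ (j ^ 2)) := by
    refine ((summable_gaussWeight h0 h1).mul_left (M + M)).of_norm_bounded fun j => ?_
    rw [norm_mul, hw]
    exact mul_le_mul_of_nonneg_right (ha' j) (pow_nonneg h0 _)
  refine ⟨hsa, ?_⟩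
  have hpart : ∀ n, ∑ j ∈ Finset.range n, a j * (r : ℂ) ^ (j ^ 2) =
      ∑ j ∈ Finset.range n, (∑ i ∈ Finset.range (j + 1), a i) * (1 - (r : ℂ) ^ (2 * j + 1)) *
        (r : ℂ) ^ (j ^ 2) + (∑ j ∈ Finset.range n, a j) * (r : ℂ) ^ (n ^ 2) := by
    intro n
    induction n with
    | zero => simp
    | succ n ih => rw [Finset.sum_range_succ, ih, Finset.sum_range_succ _ n,
        Finset.sum_range_succ _ n]; ring
  have hz : Tendsto (fun n => (∑ j ∈ Finset.range n, a j) * (r : ℂ) ^ (n ^ 2)) atTop (𝓝 0) := by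
    refine squeeze_zero_norm (a := fun n => M * r ^ (n ^ 2)) (fun n => ?_) ?_
    · rw [norm_mul, hw]
      exact mul_le_mul_of_nonneg_right (ha n) (pow_nonneg h0 _)
    · simpa using (summable_gaussWeight h0 h1).tendsto_atTop_zero.const_mul M
  have hlim := hs.hasSum.tendsto_sum_nat.add hz
  simp_rw [← hpart] at hlim
  rw [add_zero] at hlim
  rwa [tendsto_nhds_unique hsa.hasSum.tendsto_sum_nat hlim]

theorem exists_norm_sum_le_of_periodic {a : ℕ → ℂ} {K : ℕ} (hK : 0 < K) (ha : ∀ j, a (K + j) = a j)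
    (h0 : ∑ j ∈ Finset.range K, a j = 0) : ∃ M, ∀ n, ‖∑ j ∈ Finset.range n, a j‖ ≤ M := by
  have hp : Function.Periodic (fun n => ∑ j ∈ Finset.range n, a j) K := fun n => by
    simp only
    rw [add_comm, Finset.sum_range_add, h0, zero_add]
    simp_rw [ha]
  refine ⟨∑ m ∈ Finset.range K, ‖∑ j ∈ Finset.range m, a j‖, fun n => ?_⟩
  have : ∑ j ∈ Finset.range (n % K), a j = ∑ j ∈ Finset.range n, a j := hp.map_mod_nat n
  rw [← this]
  exact Finset.single_le_sum (f := fun m => ‖∑ j ∈ Finset.range m, a j‖)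
    (fun _ _ => norm_nonneg _) (Finset.mem_range.mpr (Nat.mod_lt n hK))

/-- Gaussian sums with asymptotically periodic coefficients are governed by the mean value. -/
theorem tendsto_tsum_mul_gaussWeight_div {ι : Type*} {l : Filter ι} {r : ι → ℝ}
    (hr : Tendsto r l (𝓝[<] 1)) {a : ℕ → ℂ} {K : ℕ} (hK : 0 < K) (ha : ∀ j, a (K + j) = a j)
    {b : ι → ℕ → ℂ} {C : ℝ} (hb : ∀ᶠ i in l, ∀ j, ‖b i j - a j‖ ≤ C * (1 - r i ^ (2 * j + 1))) :
    Tendsto (fun i => (∑' j, b i j * (r i : ℂ) ^ (j ^ 2)) / ((∑' j : ℕ, r i ^ (j ^ 2) : ℝ) : ℂ)) l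
      (𝓝 ((∑ j ∈ Finset.range K, a j) / K)) := by
  obtain ⟨μ, hμ⟩ : ∃ μ, μ = (∑ j ∈ Finset.range K, a j) / K := ⟨_, rfl⟩
  have hK' : (K : ℂ) ≠ 0 := Nat.cast_ne_zero.mpr hK.ne'
  obtain ⟨M, hM⟩ := exists_norm_sum_le_of_periodic (a := fun j => a j - μ) hK
    (fun j => by rw [ha]) (by
      rw [Finset.sum_sub_distrib, Finset.sum_const, Finset.card_range, nsmul_eq_mul, hμ,
        mul_div_cancel₀ _ hK', sub_self])
  rw [← hμ, tendsto_iff_norm_sub_tendsto_zero]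
  have hW := tendsto_tsum_gaussWeight.comp hr
  refine squeeze_zero' (g := fun i => (C + M) / ∑' j : ℕ, r i ^ (j ^ 2))
    (Eventually.of_forall fun _ => norm_nonneg _) ?_ (hW.const_div_atTop _)
  filter_upwards [hb, hr.eventually (Ioo_mem_nhdsLT zero_lt_one), hW.eventually_gt_atTop 0]
    with i hi hri hWi
  obtain ⟨hs1, hle1⟩ := norm_tsum_mul_gaussWeight_le hri.1.le hri.2 hi
  obtain ⟨hs2, hle2⟩ := norm_tsum_mul_gaussWeight_le_of_sum_le hri.1.le hri.2 hM
  simp only [Function.comp_apply] at hWi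
  have hWc : HasSum (fun j : ℕ => (r i : ℂ) ^ (j ^ 2)) ((∑' j : ℕ, r i ^ (j ^ 2) : ℝ) : ℂ) := by
    exact_mod_cast Complex.hasSum_ofReal.mpr (summable_gaussWeight hri.1.le hri.2).hasSum
  have hsum := (hs1.hasSum.add hs2.hasSum).add (hWc.mul_left μ)
  have hfun : (fun j => (b i j - a j) * (r i : ℂ) ^ (j ^ 2) + (a j - μ) * (r i : ℂ) ^ (j ^ 2) +
      μ * (r i : ℂ) ^ (j ^ 2)) = fun j => b i j * (r i : ℂ) ^ (j ^ 2) := by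
    funext j; ring
  rw [hfun] at hsum
  have hWne : ((∑' j : ℕ, r i ^ (j ^ 2) : ℝ) : ℂ) ≠ 0 := Complex.ofReal_ne_zero.mpr hWi.ne'
  rw [hsum.tsum_eq, add_div, mul_div_cancel_right₀ _ hWne, add_sub_cancel_right, norm_div,
    Complex.norm_real, Real.norm_of_nonneg hWi.le]
  exact div_le_div_of_nonneg_right ((norm_add_le _ _).trans (add_le_add hle1 hle2)) hWi.le

theorem tendsto_thetaSum_div {ι : Type*} {l : Filter ι} {r : ι → ℝ} (hr : Tendsto r l (𝓝[<] 1))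
    {ω : ℂ} {K : ℕ} (hω : ω ^ K = 1) (hK0 : 0 < K) (hK : Even K) :
    Tendsto (fun i => (∑' j : ℕ, (-1) ^ j * (ω * r i) ^ (j ^ 2) * (1 - (ω * r i) ^ (2 * j + 1))) /
      ((∑' j : ℕ, r i ^ (j ^ 2) : ℝ) : ℂ)) l
      (𝓝 ((2 * ∑ n ∈ Finset.range K, (-1) ^ n * ω ^ (n ^ 2)) / K)) := by
  have hn := Complex.norm_eq_one_of_pow_eq_one hω hK0.ne'
  have hp : ∀ e d : ℕ, ω ^ (K * e + d) = ω ^ d := fun e d => by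
    rw [pow_add, pow_mul, hω, one_pow, one_mul]
  have h := tendsto_tsum_mul_gaussWeight_div hr
    (a := fun j => (-1) ^ j * ω ^ (j ^ 2) * (1 - ω ^ (2 * j + 1))) hK0 (fun j => by
      rw [show (K + j) ^ 2 = K * (K + 2 * j) + j ^ 2 by ring,
        show 2 * (K + j) + 1 = K * 2 + (2 * j + 1) by ring, hp, hp, pow_add, hK.neg_one_pow,
        one_mul])
    (b := fun i j => (-1) ^ j * ω ^ (j ^ 2) * (1 - (ω * r i) ^ (2 * j + 1))) (C := 1) (by
      filter_upwards [hr.eventually (Ioo_mem_nhdsLT zero_lt_one)] with i hi j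
      have h1 : (-1) ^ j * ω ^ (j ^ 2) * (1 - (ω * r i) ^ (2 * j + 1)) -
          (-1) ^ j * ω ^ (j ^ 2) * (1 - ω ^ (2 * j + 1)) =
          (-1) ^ j * ω ^ (j ^ 2) * ω ^ (2 * j + 1) * ((1 - r i ^ (2 * j + 1) : ℝ) : ℂ) := by
        push_cast; ring
      rw [h1]
      simp only [norm_mul, norm_pow, norm_neg, norm_one, one_pow, hn, one_mul, Complex.norm_real]
      exact (Real.norm_of_nonneg (sub_nonneg.mpr (pow_le_one₀ hi.1.le hi.2.le))).le)
  have hs : ∑ j ∈ Finset.range K, (-1) ^ j * ω ^ (j ^ 2) * (1 - ω ^ (2 * j + 1)) =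
      2 * ∑ n ∈ Finset.range K, (-1) ^ n * ω ^ (n ^ 2) := by
    have h2 := sum_range_shift (f := fun n => (-1) ^ n * ω ^ (n ^ 2)) (K := K) (by
      rw [sq, pow_mul, hω, hK.neg_one_pow]; simp)
    rw [two_mul]
    nth_rewrite 2 [← h2]
    rw [← Finset.sum_add_distrib]
    exact Finset.sum_congr rfl fun n _ => by ring
  rw [hs] at h
  refine h.congr fun i => ?_
  congr 1
  exact tsum_congr fun j => by ring

theorem norm_one_sub_le_two_mul {u : ℂ} (hu : ‖u‖ = 1) {ρ : ℝ} (h0 : 0 ≤ ρ) (h1 : ρ ≤ 1) :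
    ‖1 - u‖ ≤ 2 * ‖1 - u * ρ‖ := by
  have hn : ‖u * ρ‖ = ρ := by rw [norm_mul, hu, one_mul, Complex.norm_real, Real.norm_of_nonneg h0]
  have h2 : 1 - ρ ≤ ‖1 - u * ρ‖ := by
    have := norm_sub_norm_le 1 (u * ρ)
    rwa [norm_one, hn] at this
  have h3 : ‖1 - u‖ ≤ ‖1 - u * ρ‖ + ‖u * ((ρ - 1 : ℝ) : ℂ)‖ := by
    refine le_trans (le_of_eq ?_) (norm_add_le _ _)
    congr 1
    push_cast
    ring
  rw [norm_mul, hu, one_mul, Complex.norm_real, Real.norm_of_nonpos (by linarith)] at h3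
  linarith

theorem norm_one_sub_pow_le {u : ℂ} (hu : ‖u‖ = 1) (n : ℕ) : ‖1 - u ^ n‖ ≤ n * ‖1 - u‖ := by
  induction n with
  | zero => simp
  | succ n ih =>
    have h : 1 - u ^ (n + 1) = (1 - u ^ n) + u ^ n * (1 - u) := by ring
    rw [h]
    refine (norm_add_le _ _).trans ?_
    rw [norm_mul, norm_pow, hu, one_pow, one_mul]
    push_cast
    linarith

/-- Uniform distance from the poles on segments ending at `x ω ^ j`. -/
theorem norm_one_sub_pow_div_le {x ω : ℂ} {K : ℕ} (hx : ‖x‖ = 1) (hω : ω ^ K = 1) (hK : 0 < K)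
    (j : ℕ) {ρ : ℝ} (h0 : 0 ≤ ρ) (h1 : ρ ≤ 1) :
    ‖1 - x ^ K‖ / (2 * K) ≤ ‖1 - x * ω ^ j * ρ‖ := by
  have hu : ‖x * ω ^ j‖ = 1 := by
    rw [norm_mul, norm_pow, hx, Complex.norm_eq_one_of_pow_eq_one hω hK.ne', one_pow, one_mul]
  have h2 := norm_one_sub_pow_le hu K
  rw [mul_pow, ← pow_mul, mul_comm j, pow_mul, hω, one_pow, mul_one] at h2
  have h3 := norm_one_sub_le_two_mul hu h0 h1
  have hK' : (0 : ℝ) < K := Nat.cast_pos.mpr hK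
  rw [div_le_iff₀ (by positivity)]
  calc _ ≤ (K : ℝ) * ‖1 - x * ω ^ j‖ := h2
    _ ≤ K * (2 * ‖1 - x * ω ^ j * ρ‖) := mul_le_mul_of_nonneg_left h3 hK'.le
    _ = _ := by ring

theorem norm_one_sub_inv {z : ℂ} (hz : ‖z‖ = 1) : ‖1 - z⁻¹‖ = ‖1 - z‖ := by
  have hz0 : z ≠ 0 := norm_ne_zero_iff.mp (by rw [hz]; exact one_ne_zero)
  have h : 1 - z⁻¹ = -(1 - z) * z⁻¹ := by field_simp; ring
  rw [h, norm_mul, norm_neg, norm_inv, hz, inv_one, mul_one]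

theorem norm_inv_one_sub_sub_le {u : ℂ} (hu : ‖u‖ = 1) {ρ c : ℝ} (h1 : ρ ≤ 1)
    (hc : 0 < c) (hρ : c ≤ ‖1 - u * ρ‖) (hc1 : c ≤ ‖1 - u‖) :
    ‖(1 - u * ρ)⁻¹ - (1 - u)⁻¹‖ ≤ (1 - ρ) / c ^ 2 := by
  have hn1 : 1 - u * ρ ≠ 0 := norm_pos_iff.mp (hc.trans_le hρ)
  have hn2 : 1 - u ≠ 0 := norm_pos_iff.mp (hc.trans_le hc1)
  rw [inv_sub_inv hn1 hn2, norm_div, norm_mul,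
    show (1 - u) - (1 - u * ρ) = u * ((ρ - 1 : ℝ) : ℂ) by push_cast; ring, norm_mul, hu, one_mul,
    Complex.norm_real, Real.norm_of_nonpos (by linarith), neg_sub, sq]
  exact div_le_div_of_nonneg_left (by linarith) (by positivity)
    (mul_le_mul hρ hc1 hc.le (norm_nonneg _))

theorem sum_symmetrized_appellTerm {x ω : ℂ} {K : ℕ} (hω : ω ^ K = 1) (hK : Even K) (hx : x ≠ 0)
    (hxK : x ^ K ≠ 1) :
    ∑ j ∈ Finset.range K, (-1) ^ j * ω ^ (j * (j + 1)) *
      ((1 - x * ω ^ j)⁻¹ + (1 - x⁻¹ * ω ^ (j + 1))⁻¹ - 1) =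
      2 * ∑ n ∈ Finset.range K, appellTerm x ω n := by
  have h := Finset.sum_range_reflect (fun n => (-1 : ℂ) ^ n * ω ^ (n * (n + 1)) *
    ((1 - x⁻¹ * ω ^ (n + 1))⁻¹ - 1)) K
  rw [two_mul]
  have h2 : ∑ n ∈ Finset.range K, (-1 : ℂ) ^ n * ω ^ (n * (n + 1)) *
    ((1 - x⁻¹ * ω ^ (n + 1))⁻¹ - 1) = ∑ n ∈ Finset.range K, appellTerm x ω n := by
    rw [← h]
    refine Finset.sum_congr rfl fun n hn => ?_
    have hn := Finset.mem_range.mp hn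
    have hω0 : ω ≠ 0 := fun h0 => by simp [h0, show K ≠ 0 by omega] at hω
    have h3 := one_sub_mul_pow_ne_zero hω hxK n
    have h4 : x * ω ^ n ≠ 0 := mul_ne_zero hx (pow_ne_zero _ hω0)
    have h5 : x * ω ^ n - 1 ≠ 0 := fun h0 => h3 (by rw [← neg_sub, h0, neg_zero])
    rw [pow_reflect hω (show K - 1 - n + n + 1 = K by omega),
      neg_one_pow_reflect hK (show K - 1 - n + n + 1 = K by omega),
      pow_eq_inv_of_add_eq hω (show K - 1 - n + 1 + n = K by omega), appellTerm, ← mul_inv]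
    have h6 : (1 - (x * ω ^ n)⁻¹)⁻¹ - 1 = -(1 - x * ω ^ n)⁻¹ := by
      generalize x * ω ^ n = u at *
      rw [show 1 - u⁻¹ = (u - 1) / u by field_simp]
      field_simp
      ring
    rw [h6]
    ring
  nth_rewrite 2 [← h2]
  rw [← Finset.sum_add_distrib]
  refine Finset.sum_congr rfl fun n _ => ?_
  rw [appellTerm]
  ring

theorem radii_mem_Icc {r s : ℝ} (hr0 : 0 < r) (hr1 : r ≤ 1) (hrs : r ≤ s) (hs : s ≤ 1) (j : ℕ) :
    s * r ^ j ∈ Set.Icc (r ^ (2 * j + 1)) 1 ∧ s⁻¹ * r ^ (j + 1) ∈ Set.Icc (r ^ (2 * j + 1)) 1 := by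
  have hs0 : 0 < s := hr0.trans_le hrs
  have hpow : r ^ j ≤ 1 := pow_le_one₀ hr0.le hr1
  have hle : r ^ (2 * j + 1) ≤ r ^ (j + 1) := pow_le_pow_of_le_one hr0.le hr1 (by omega)
  refine ⟨⟨hle.trans ?_, mul_le_one₀ hs (by positivity) hpow⟩,
    hle.trans (le_mul_of_one_le_left (by positivity) ((one_le_inv₀ hs0).mpr hs)), ?_⟩
  · rw [pow_succ']
    exact mul_le_mul_of_nonneg_right hrs (by positivity)
  · rw [inv_mul_le_iff₀ hs0, mul_one, pow_succ]
    exact (mul_le_of_le_one_left hr0.le hpow).trans hrs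

theorem lambert_arg_eq (x ω : ℂ) (r s : ℝ) (j : ℕ) :
    x * s * (ω * r) ^ j = x * ω ^ j * (s * r ^ j : ℝ) ∧
      (x * s)⁻¹ * (ω * r) * (ω * r) ^ j = x⁻¹ * ω ^ (j + 1) * (s⁻¹ * r ^ (j + 1) : ℝ) := by
  constructor
  · push_cast; ring
  · push_cast; rw [mul_inv]; ring

theorem tendsto_lambertSum_div {ι : Type*} {l : Filter ι} {r s : ι → ℝ}
    (hr : Tendsto r l (𝓝[<] 1)) (hs : ∀ᶠ i in l, r i ≤ s i ∧ s i ≤ 1) {x ω : ℂ} {K : ℕ}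
    (hω : ω ^ K = 1) (hK0 : 0 < K) (hK : Even K) (hx : ‖x‖ = 1) (hxK : x ^ K ≠ 1) :
    Tendsto (fun i => (∑' j : ℕ, (-1) ^ j * (ω * r i) ^ (j * (j + 1)) *
      (1 - (ω * r i) ^ (2 * j + 1)) / ((1 - x * s i * (ω * r i) ^ j) *
        (1 - (x * s i)⁻¹ * (ω * r i) * (ω * r i) ^ j))) /
      ((∑' j : ℕ, r i ^ (j ^ 2) : ℝ) : ℂ)) l
      (𝓝 ((2 * ∑ n ∈ Finset.range K, appellTerm x ω n) / K)) := by
  have hn := Complex.norm_eq_one_of_pow_eq_one hω hK0.ne'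
  have hx0 : x ≠ 0 := norm_ne_zero_iff.mp (by rw [hx]; exact one_ne_zero)
  have hxi : ‖x⁻¹‖ = 1 := by rw [norm_inv, hx, inv_one]
  have hp : ∀ e d : ℕ, ω ^ (K * e + d) = ω ^ d := fun e d => by
    rw [pow_add, pow_mul, hω, one_pow, one_mul]
  obtain ⟨c, hc⟩ : ∃ c, c = ‖1 - x ^ K‖ / (2 * K) := ⟨_, rfl⟩
  have hc0 : 0 < c := by
    rw [hc]
    exact div_pos (norm_pos_iff.mpr (sub_ne_zero.mpr hxK.symm)) (by positivity)
  have hu := fun (j : ℕ) {ρ : ℝ} (h0 : 0 ≤ ρ) (h1 : ρ ≤ 1) =>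
    norm_one_sub_pow_div_le hx hω hK0 j h0 h1
  have hv := fun (j : ℕ) {ρ : ℝ} (h0 : 0 ≤ ρ) (h1 : ρ ≤ 1) =>
    norm_one_sub_pow_div_le hxi hω hK0 j h0 h1
  rw [inv_pow, norm_one_sub_inv (by rw [norm_pow, hx, one_pow])] at hv
  rw [← hc] at hu hv
  have hu1 : ∀ j, c ≤ ‖1 - x * ω ^ j‖ := fun j => by simpa using hu j zero_le_one le_rfl
  have hv1 : ∀ j, c ≤ ‖1 - x⁻¹ * ω ^ j‖ := fun j => by simpa using hv j zero_le_one le_rfl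
  have h := tendsto_tsum_mul_gaussWeight_div hr
    (a := fun j => (-1) ^ j * ω ^ (j * (j + 1)) *
      ((1 - x * ω ^ j)⁻¹ + (1 - x⁻¹ * ω ^ (j + 1))⁻¹ - 1)) hK0 (fun j => by
      rw [show (K + j) * (K + j + 1) = K * (K + 2 * j + 1) + j * (j + 1) by ring, hp,
        pow_add (-1 : ℂ), hK.neg_one_pow, one_mul, add_assoc K j 1, pow_add ω K, pow_add ω K, hω,
        one_mul, one_mul])
    (b := fun i j => (-1) ^ j * ω ^ (j * (j + 1)) * ((r i : ℂ) ^ j *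
      ((1 - x * ω ^ j * (s i * r i ^ j : ℝ))⁻¹ +
        (1 - x⁻¹ * ω ^ (j + 1) * ((s i)⁻¹ * r i ^ (j + 1) : ℝ))⁻¹ - 1)))
    (C := 2 / c ^ 2 + (2 / c + 1)) (by
      filter_upwards [hr.eventually (Ioo_mem_nhdsLT zero_lt_one), hs] with i hi hsi j
      have hr0 : 0 < r i := hi.1
      have hpow1 : r i ^ j ≤ 1 := pow_le_one₀ hr0.le hi.2.le
      have hle' : r i ^ (2 * j + 1) ≤ r i ^ j := pow_le_pow_of_le_one hr0.le hi.2.le (by omega)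
      have hpos := pow_nonneg hr0.le (2 * j + 1)
      obtain ⟨⟨hρ, hρ1⟩, hσ, hσ1⟩ := radii_mem_Icc hr0 hi.2.le hsi.1 hsi.2 j
      have hρ0 := hpos.trans hρ
      have hσ0 := hpos.trans hσ
      have hun : ‖x * ω ^ j‖ = 1 := by rw [norm_mul, norm_pow, hx, hn, one_pow, one_mul]
      have hvn : ‖x⁻¹ * ω ^ (j + 1)‖ = 1 := by rw [norm_mul, norm_pow, hxi, hn, one_pow, one_mul]
      have hU := norm_inv_one_sub_sub_le hun hρ1 hc0 (hu j hρ0 hρ1) (hu1 j)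
      have hV := norm_inv_one_sub_sub_le hvn hσ1 hc0 (hv (j + 1) hσ0 hσ1) (hv1 (j + 1))
      have hU1 : ‖(1 - x * ω ^ j)⁻¹‖ ≤ 1 / c := by
        rw [norm_inv, inv_eq_one_div]; exact one_div_le_one_div_of_le hc0 (hu1 j)
      have hV1 : ‖(1 - x⁻¹ * ω ^ (j + 1))⁻¹‖ ≤ 1 / c := by
        rw [norm_inv, inv_eq_one_div]; exact one_div_le_one_div_of_le hc0 (hv1 (j + 1))
      have hrn : ‖(r i : ℂ) ^ j‖ = r i ^ j := by
        rw [norm_pow, Complex.norm_real, Real.norm_of_nonneg hr0.le]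
      have hrn1 : ‖(r i : ℂ) ^ j - 1‖ = 1 - r i ^ j := by
        rw [← Complex.ofReal_pow, ← Complex.ofReal_one, ← Complex.ofReal_sub, Complex.norm_real,
          Real.norm_of_nonpos (by linarith), neg_sub]
      rw [← mul_sub, norm_mul, norm_mul, norm_pow, norm_pow, norm_neg, norm_one, hn, one_pow,
        one_pow, one_mul, one_mul]
      generalize (1 - x * ω ^ j * (s i * r i ^ j : ℝ))⁻¹ = P at *
      generalize (1 - x⁻¹ * ω ^ (j + 1) * ((s i)⁻¹ * r i ^ (j + 1) : ℝ))⁻¹ = Q at *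
      generalize (1 - x * ω ^ j)⁻¹ = P₀ at *
      generalize (1 - x⁻¹ * ω ^ (j + 1))⁻¹ = Q₀ at *
      have hc2 : 0 < c ^ 2 := by positivity
      have hdec : (r i : ℂ) ^ j * (P + Q - 1) - (P₀ + Q₀ - 1) =
          (r i : ℂ) ^ j * ((P - P₀) + (Q - Q₀)) + ((r i : ℂ) ^ j - 1) * (P₀ + Q₀ - 1) := by ring
      have hδ : 0 ≤ 1 - r i ^ (2 * j + 1) := by linarith
      have hU' : ‖P - P₀‖ ≤ (1 - r i ^ (2 * j + 1)) / c ^ 2 :=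
        hU.trans (div_le_div_of_nonneg_right (by linarith) hc2.le)
      have hV' : ‖Q - Q₀‖ ≤ (1 - r i ^ (2 * j + 1)) / c ^ 2 :=
        hV.trans (div_le_div_of_nonneg_right (by linarith) hc2.le)
      have hPQ : ‖P₀ + Q₀ - 1‖ ≤ 2 / c + 1 := by
        refine (norm_sub_le _ _).trans ?_
        rw [norm_one]
        have := norm_add_le P₀ Q₀
        have h2c : 2 / c = 1 / c + 1 / c := by ring
        linarith
      rw [hdec]
      calc _ ≤ ‖(r i : ℂ) ^ j * ((P - P₀) + (Q - Q₀))‖ +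
            ‖((r i : ℂ) ^ j - 1) * (P₀ + Q₀ - 1)‖ := norm_add_le _ _
        _ ≤ 1 * ((1 - r i ^ (2 * j + 1)) / c ^ 2 + (1 - r i ^ (2 * j + 1)) / c ^ 2) +
            (1 - r i ^ (2 * j + 1)) * (2 / c + 1) := by
          rw [norm_mul, norm_mul, hrn, hrn1]
          exact add_le_add (mul_le_mul hpow1 ((norm_add_le _ _).trans (add_le_add hU' hV'))
            (norm_nonneg _) zero_le_one)
            (mul_le_mul (by linarith) hPQ (norm_nonneg _) hδ)
        _ = _ := by ring)
  rw [sum_symmetrized_appellTerm hω hK hx0 hxK] at h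
  refine h.congr' ?_
  filter_upwards [hr.eventually (Ioo_mem_nhdsLT zero_lt_one), hs] with i hi hsi
  congr 1
  refine tsum_congr fun j => ?_
  have hr0 : 0 < r i := hi.1
  have hs0 : 0 < s i := hi.1.trans_le hsi.1
  have hpos := pow_nonneg hr0.le (2 * j + 1)
  obtain ⟨⟨hρ, hρ1⟩, hσ, hσ1⟩ := radii_mem_Icc hr0 hi.2.le hsi.1 hsi.2 j
  have hP := norm_pos_iff.mp (hc0.trans_le (hu j (hpos.trans hρ) hρ1))
  have hQ := norm_pos_iff.mp (hc0.trans_le (hv (j + 1) (hpos.trans hσ) hσ1))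
  have hs' : (s i : ℂ) ≠ 0 := Complex.ofReal_ne_zero.mpr hs0.ne'
  obtain ⟨e1, e2⟩ := lambert_arg_eq x ω (r i) (s i) j
  have e3 : (ω * r i) ^ (2 * j + 1) = x * ω ^ j * (s i * r i ^ j : ℝ) *
      (x⁻¹ * ω ^ (j + 1) * ((s i)⁻¹ * r i ^ (j + 1) : ℝ)) := by
    push_cast; field_simp; ring
  have e4 : (ω * r i) ^ (j * (j + 1)) = ω ^ (j * (j + 1)) * ((r i : ℂ) ^ j * (r i : ℂ) ^ (j ^ 2)) := by
    rw [mul_pow]; ring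
  rw [e1, e2, e3, e4]
  generalize x * ω ^ j * (s i * r i ^ j : ℝ) = y at *
  generalize x⁻¹ * ω ^ (j + 1) * ((s i)⁻¹ * r i ^ (j + 1) : ℝ) = z at *
  generalize ω ^ (j * (j + 1)) = W
  field_simp
  ring

theorem tendsto_g2 {ι : Type*} {l : Filter ι} {r s : ι → ℝ} (hr : Tendsto r l (𝓝[<] 1))
    (hs : ∀ᶠ i in l, r i ≤ s i ∧ s i ≤ 1) {x ω : ℂ} {m : ℕ} (hm : m ≠ 0)
    (hω : IsPrimitiveRoot ω (2 * m)) (hx : ‖x‖ = 1) (hxK : x ^ (2 * m) ≠ 1) :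
    Tendsto (fun i => g2 (x * s i) (ω * r i)) l (𝓝 (∑ n ∈ Finset.range m, g2Term x ω n)) := by
  have hK0 : 0 < 2 * m := by omega
  have hKc : ((2 * m : ℕ) : ℂ) ≠ 0 := Nat.cast_ne_zero.mpr hK0.ne'
  have hx0 : x ≠ 0 := norm_ne_zero_iff.mp (by rw [hx]; exact one_ne_zero)
  have hG := gaussSum_ne_zero hω hK0.ne' (even_two_mul m)
  have hωm : ω ^ m = -1 := (hω.pow hK0 (mul_comm 2 m)).eq_neg_one_of_two_right
  have h := (tendsto_lambertSum_div hr hs hω.pow_eq_one hK0 (even_two_mul m) hx hxK).div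
    (tendsto_thetaSum_div hr hω.pow_eq_one hK0 (even_two_mul m))
    (div_ne_zero (mul_ne_zero two_ne_zero hG) hKc)
  rw [div_div_div_cancel_right₀ hKc, mul_div_mul_left _ _ two_ne_zero,
    ← sum_g2Term_mul_gaussSum hm hωm hx hxK, mul_div_cancel_right₀ _ hG] at h
  refine h.congr' ?_
  filter_upwards [hr.eventually (Ioo_mem_nhdsLT zero_lt_one), hs,
    (tendsto_tsum_gaussWeight.comp hr).eventually_gt_atTop 0] with i hi hsi hWi
  have hW : ((∑' j : ℕ, r i ^ (j ^ 2) : ℝ) : ℂ) ≠ 0 := Complex.ofReal_ne_zero.mpr hWi.ne'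
  have hr0 : 0 < r i := hi.1
  have hs0 : (s i : ℂ) ≠ 0 := Complex.ofReal_ne_zero.mpr (hi.1.trans_le hsi.1).ne'
  have hq : ‖ω * r i‖ < 1 := by
    rw [norm_mul, Complex.norm_eq_one_of_pow_eq_one hω.pow_eq_one hK0.ne', one_mul,
      Complex.norm_real, Real.norm_of_nonneg hr0.le]
    exact hi.2
  have hθ := left_ne_zero_of_mul_eq_one (tsum_gaussTerm_mul_theta hq)
  have hc0 : 0 < ‖1 - x ^ (2 * m)‖ / (2 * (2 * m : ℕ)) :=
    div_pos (norm_pos_iff.mpr (sub_ne_zero.mpr hxK.symm)) (by positivity)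
  have hg := g2_mul_theta hq (mul_ne_zero hx0 hs0) hc0 (fun j => by
    obtain ⟨⟨hρ, hρ1⟩, -⟩ := radii_mem_Icc hr0 hi.2.le hsi.1 hsi.2 j
    rw [(lambert_arg_eq x ω (r i) (s i) j).1]
    exact norm_one_sub_pow_div_le hx hω.pow_eq_one hK0 j ((pow_nonneg hr0.le _).trans hρ) hρ1)
    (fun j => by
    obtain ⟨-, hσ, hσ1⟩ := radii_mem_Icc hr0 hi.2.le hsi.1 hsi.2 j
    have hxi : ‖x⁻¹‖ = 1 := by rw [norm_inv, hx, inv_one]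
    rw [(lambert_arg_eq x ω (r i) (s i) j).2, ← norm_one_sub_inv (by rw [norm_pow, hx, one_pow]),
      ← inv_pow]
    exact norm_one_sub_pow_div_le hxi hω.pow_eq_one hK0 (j + 1)
      ((pow_nonneg hr0.le _).trans hσ) hσ1)
  simp only [Pi.div_apply]
  rw [div_div_div_cancel_right₀ hW, ← hg, mul_div_cancel_right₀ _ hθ]

theorem zeta_neg (m : ℤ) (n : ℕ) : zeta (-m) n = (zeta m n)⁻¹ := by
  rw [zeta, zeta, ee, ee, ← Complex.exp_neg]
  congr 1
  push_cast
  ring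

theorem zeta_sub (m l : ℤ) (n : ℕ) : zeta (m - l) n = zeta m n * (zeta l n)⁻¹ := by
  rw [← zeta_neg, zeta, zeta, zeta, ee, ee, ee, ← Complex.exp_add]
  congr 1
  push_cast
  ring

theorem norm_zeta (m : ℤ) (n : ℕ) : ‖zeta m n‖ = 1 := by
  rw [zeta, ee, show 2 * Real.pi * Complex.I * ((m : ℂ) / (n : ℂ)) =
    ((2 * Real.pi * (m / n) : ℝ) : ℂ) * Complex.I by push_cast; ring]
  exact Complex.norm_exp_ofReal_mul_I _

theorem qT_pow (h k : ℕ) (t : ℝ) (n : ℕ) :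
    qT h k t ^ n = zeta (h * n) k * ((Real.exp (-t) ^ n : ℝ) : ℂ) := by
  rw [qT, ee, tauT, zeta, ee, ← Real.exp_nat_mul, Complex.ofReal_exp, ← Complex.exp_add,
    ← Complex.exp_nat_mul]
  congr 1
  have hπ : (Real.pi : ℂ) ≠ 0 := Complex.ofReal_ne_zero.mpr Real.pi_ne_zero
  push_cast
  field_simp
  linear_combination (n * t : ℂ) * Complex.I_sq

theorem isPrimitiveRoot_zeta_mul {h k : ℕ} (B : ℕ) (hk : k ≠ 0) (hhk : Nat.Coprime h k) :
    IsPrimitiveRoot (zeta (h * B) k) (k / Nat.gcd k B) := by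
  have hg : 0 < Nat.gcd k B := Nat.gcd_pos_of_pos_left _ (Nat.pos_of_ne_zero hk)
  obtain ⟨K, hK⟩ := Nat.gcd_dvd_left k B
  obtain ⟨B', hB'⟩ := Nat.gcd_dvd_right k B
  have hcop := Nat.coprime_div_gcd_div_gcd hg
  generalize Nat.gcd k B = g at *
  subst hK hB'
  rw [Nat.mul_div_cancel_left _ hg] at hcop ⊢
  rw [Nat.mul_div_cancel_left _ hg] at hcop
  have h1 := Complex.isPrimitiveRoot_exp_of_coprime (h * B') K (right_ne_zero_of_mul hk)
    (Nat.Coprime.mul_left hhk.coprime_mul_left_right hcop.symm)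
  have hg' : (g : ℂ) ≠ 0 := Nat.cast_ne_zero.mpr hg.ne'
  convert h1 using 1
  rw [zeta, ee]
  congr 2
  push_cast
  rw [mul_left_comm, mul_div_mul_left _ _ hg']

theorem two_dvd_div_gcd {k B : ℕ} (hB : B ≠ 0)
    (hval : padicValNat 2 B < padicValNat 2 k) : 2 ∣ k / Nat.gcd k B := by
  by_contra hodd
  have hcop : Nat.Coprime (2 ^ padicValNat 2 k) (k / Nat.gcd k B) :=
    Nat.Coprime.pow_left _ ((Nat.Prime.coprime_iff_not_dvd Nat.prime_two).mpr hodd)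
  have h1 : 2 ^ padicValNat 2 k ∣ Nat.gcd k B * (k / Nat.gcd k B) := by
    rw [Nat.mul_div_cancel' (Nat.gcd_dvd_left k B)]
    exact pow_padicValNat_dvd
  have h2 := (hcop.dvd_of_dvd_mul_right h1).trans (Nat.gcd_dvd_right k B)
  exact absurd ((padicValNat_dvd_iff_le hB).mp h2) (not_le.mpr hval)

theorem zeta_mul_zeta_pow_ne_one {a b A B h k : ℕ} (hb : b ≠ 0) (hk : k ≠ 0)
    (hgab : Nat.Coprime a b)
    (hQ : ¬(b ∣ k ∧ Nat.gcd B k ∣ (a * (k / b) + h * A))) :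
    (zeta a b * zeta (h * A) k) ^ (k / Nat.gcd k B) ≠ 1 := by
  intro hone
  apply hQ
  rw [Nat.gcd_comm B k]
  have hg : 0 < Nat.gcd k B := Nat.gcd_pos_of_pos_left _ (Nat.pos_of_ne_zero hk)
  obtain ⟨K, hK⟩ := Nat.gcd_dvd_left k B
  generalize Nat.gcd k B = g at *
  subst hK
  rw [Nat.mul_div_cancel_left _ hg, zeta, zeta, ee, ee, ← Complex.exp_add, ← Complex.exp_nat_mul,
    Complex.exp_eq_one_iff] at hone
  obtain ⟨n, hn⟩ := hone
  have hg' : (g : ℂ) ≠ 0 := Nat.cast_ne_zero.mpr hg.ne'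
  have hb' : (b : ℂ) ≠ 0 := Nat.cast_ne_zero.mpr hb
  have hK' : (K : ℂ) ≠ 0 := Nat.cast_ne_zero.mpr (right_ne_zero_of_mul hk)
  have hn' : (a * (g * K) + h * A * b : ℂ) = n * g * b := by
    have h2 : (K : ℂ) * (a / b + h * A / (g * K)) = n := by
      refine mul_right_cancel₀ Complex.two_pi_I_ne_zero ?_
      rw [← hn]
      push_cast
      ring
    rw [← h2]
    field_simp
  have hZ : (a * (g * K) + h * A * b : ℤ) = n * g * b := by exact_mod_cast hn'
  have hdvd : b ∣ g * K := by
    refine hgab.symm.dvd_of_dvd_mul_left ?_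
    have : (b : ℤ) ∣ ((a * (g * K) : ℕ) : ℤ) := ⟨n * g - h * A, by push_cast; linarith⟩
    exact_mod_cast this
  refine ⟨hdvd, ?_⟩
  obtain ⟨c, hc⟩ := hdvd
  rw [hc, Nat.mul_div_cancel_left _ (Nat.pos_of_ne_zero hb)]
  have hc' : (g * K : ℤ) = b * c := by exact_mod_cast hc
  have : (g : ℤ) ∣ ((a * c + h * A : ℕ) : ℤ) := by
    refine ⟨n, mul_right_cancel₀ (Nat.cast_ne_zero.mpr hb : (b : ℤ) ≠ 0) ?_⟩
    rw [hc'] at hZ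
    push_cast
    linarith
  exact_mod_cast this

/-- Proposition 5.2: radial limit of g₂ when the numerator terminates. -/
theorem statement11 (a b A B h k : ℕ) (hb : 1 ≤ b) (hB : 1 ≤ B) (hk : 1 ≤ k)
    (hab : a < b) (hAB : A < B) (hhk : h < k)
    (hgab : Nat.gcd a b = 1) (hgAB : Nat.gcd A B = 1) (hghk : Nat.gcd h k = 1)
    (hpos : 0 < a + A)
    (hQ : ¬(b ∣ k ∧ Nat.gcd B k ∣ (a * (k / b) + h * A)))
    (hval : padicValNat 2 B < padicValNat 2 k) :
    2 ∣ k / Nat.gcd k B ∧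
    (∀ n : ℕ, n < k / Nat.gcd k B / 2 →
      qPoch (zeta a b * zeta ((h : ℤ) * (A : ℤ)) k) (zeta ((h : ℤ) * (B : ℤ)) k) (n + 1) ≠ 0 ∧
      qPoch (zeta (-(a : ℤ)) b * zeta ((h : ℤ) * ((B : ℤ) - (A : ℤ))) k)
        (zeta ((h : ℤ) * (B : ℤ)) k) (n + 1) ≠ 0) ∧
    Filter.Tendsto
      (fun t : ℝ => g2 (zeta a b * qT h k t ^ A) (qT h k t ^ B))
      (𝓝[>] (0 : ℝ))
      (𝓝 (∑ n ∈ Finset.range (k / Nat.gcd k B / 2),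
        (zeta ((h : ℤ) * (B : ℤ)) k) ^ (n * (n + 1) / 2) *
          qPoch (-(zeta ((h : ℤ) * (B : ℤ)) k)) (zeta ((h : ℤ) * (B : ℤ)) k) n /
          (qPoch (zeta a b * zeta ((h : ℤ) * (A : ℤ)) k) (zeta ((h : ℤ) * (B : ℤ)) k) (n + 1) *
            qPoch (zeta (-(a : ℤ)) b * zeta ((h : ℤ) * ((B : ℤ) - (A : ℤ))) k)
              (zeta ((h : ℤ) * (B : ℤ)) k) (n + 1)))) := by
  obtain ⟨m, hm⟩ := two_dvd_div_gcd (by omega : B ≠ 0) hval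
  have hω := isPrimitiveRoot_zeta_mul B (by omega : k ≠ 0) hghk
  have hxK := zeta_mul_zeta_pow_ne_one (by omega : b ≠ 0) (by omega : k ≠ 0) hgab hQ
  have hKpos : 0 < k / Nat.gcd k B :=
    Nat.div_pos (Nat.gcd_le_left _ (by omega)) (Nat.gcd_pos_of_pos_left _ (by omega))
  have hy : zeta (-(a : ℤ)) b * zeta ((h : ℤ) * ((B : ℤ) - (A : ℤ))) k =
      (zeta a b * zeta ((h : ℤ) * (A : ℤ)) k)⁻¹ * zeta ((h : ℤ) * (B : ℤ)) k := by
    rw [mul_sub, zeta_sub, zeta_neg, mul_inv]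
    ring
  have hx : ‖zeta a b * zeta ((h : ℤ) * (A : ℤ)) k‖ = 1 := by
    rw [norm_mul, norm_zeta, norm_zeta, one_mul]
  rw [hm] at hω hxK hKpos
  rw [hm, hy, Nat.mul_div_cancel_left m two_pos]
  refine ⟨dvd_mul_right 2 m, fun n _ =>
    ⟨qPoch_ne_zero (one_sub_mul_pow_ne_zero hω.pow_eq_one hxK) _,
      qPoch_ne_zero (one_sub_inv_mul_pow_ne_zero hω.pow_eq_one hxK) _⟩, ?_⟩
  simp_rw [qT_pow, ← mul_assoc]
  refine tendsto_g2 (r := fun t => Real.exp (-t) ^ B) (s := fun t => Real.exp (-t) ^ A) ?_ ?_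
    (by omega) hω hx hxK
  · refine tendsto_nhdsWithin_iff.mpr ⟨?_, ?_⟩
    · have hc : Continuous fun t : ℝ => Real.exp (-t) ^ B := by fun_prop
      have := hc.tendsto 0
      simp only [neg_zero, Real.exp_zero, one_pow] at this
      exact this.mono_left nhdsWithin_le_nhds
    · filter_upwards [self_mem_nhdsWithin] with t ht
      have ht : 0 < t := ht
      exact pow_lt_one₀ (Real.exp_pos _).le (Real.exp_lt_one_iff.mpr (by linarith)) (by omega)
  · filter_upwards [self_mem_nhdsWithin] with t ht
    have ht : 0 < t := ht
    have h1 : Real.exp (-t) ≤ 1 := (Real.exp_lt_one_iff.mpr (by linarith)).le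
    exact ⟨pow_le_pow_of_le_one (Real.exp_pos _).le h1 hAB.le, pow_le_one₀ (Real.exp_pos _).le h1⟩

end
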